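/- arXiv:1505.00240 — 2 statements merged into one kernel-verified Lean document; each statement's English description precedes it below -/
import Mathlib

section
/- Let μ be the product of n symmetric probability measures on ℝ each in the class M(h,λ) (i.e. μᵢ[x+h,∞) ≤ λμᵢ[x,∞) for x ≥ 0), and set C_τ = 17h/(1−λ)². Then for any convex Borel set A ⊆ ℝⁿ with μ(A) > 0 and any t > 0: μ(A + √(2t)·C_τ·B₂ⁿ + 2t·C_τ·B₁ⁿ) ≥ 1 − e^{−t}/μ(A). -/
open MeasureTheory Set Real Pointwise

lemma convexOn_partial_min {E F : Type*} [AddCommGroup E] [Module ℝ E] [AddCommGroup F] [Module ℝ F]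
    (K : Set F) (hK : Convex ℝ K) (H : E → F → ℝ) (p : E → ℝ)
    (hH : ∀ x x' y y', y ∈ K → y' ∈ K → ∀ a b : ℝ, 0 ≤ a → 0 ≤ b → a + b = 1 →
      H (a • x + b • x') (a • y + b • y') ≤ a * H x y + b * H x' y')
    (h1 : ∀ x, ∀ y ∈ K, p x ≤ H x y)
    (h2 : ∀ x, ∀ e : ℝ, 0 < e → ∃ y ∈ K, H x y < p x + e) : ConvexOn ℝ univ p := by
  refine ⟨convex_univ, fun x _ x' _ a b ha hb hab => ?_⟩
  refine le_of_forall_pos_le_add fun e he => ?_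
  obtain ⟨y, hy, hy'⟩ := h2 x e he
  obtain ⟨z, hz, hz'⟩ := h2 x' e he
  have h3 := h1 (a • x + b • x') (a • y + b • z) (hK hy hz ha hb hab)
  have h4 := hH x x' y z hy hz a b ha hb hab
  have h5 := mul_le_mul_of_nonneg_left hy'.le ha
  have h6 := mul_le_mul_of_nonneg_left hz'.le hb
  have : a * e + b * e = e := by rw [← add_mul, hab, one_mul]
  simp only [smul_eq_mul]
  linarith

/-- infimum convolution -/
noncomputable def infConv {E : Type*} [AddCommGroup E] (P f : E → ℝ) (x : E) : ℝ :=
  ⨅ y, f y + P (x - y)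

section
variable {E : Type*} [AddCommGroup E] {P f : E → ℝ}

lemma infConv_le (hP : ∀ x, 0 ≤ P x) (hf : ∀ x, 0 ≤ f x) (x y : E) :
    infConv P f x ≤ f y + P (x - y) :=
  ciInf_le ⟨0, by rintro _ ⟨y, rfl⟩; exact add_nonneg (hf _) (hP _)⟩ y

lemma le_infConv (x : E) (c : ℝ) (h : ∀ y, c ≤ f y + P (x - y)) : c ≤ infConv P f x :=
  le_ciInf h

lemma infConv_nonneg (hP : ∀ x, 0 ≤ P x) (hf : ∀ x, 0 ≤ f x) (x : E) : 0 ≤ infConv P f x :=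
  le_infConv x 0 fun _ => add_nonneg (hf _) (hP _)

lemma infConv_lt (x : E) {e : ℝ} (he : 0 < e) :
    ∃ y, f y + P (x - y) < infConv P f x + e :=
  exists_lt_of_ciInf_lt (lt_add_of_pos_right _ he)

lemma infConv_convex [Module ℝ E] (hP : ∀ x, 0 ≤ P x) (hf : ∀ x, 0 ≤ f x)
    (hPc : ConvexOn ℝ univ P) (hfc : ConvexOn ℝ univ f) : ConvexOn ℝ univ (infConv P f) := by
  refine convexOn_partial_min univ convex_univ (fun x y => f y + P (x - y)) _ ?_ ?_ ?_
  · intro x x' y y' _ _ a b ha hb hab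
    have h1 := hfc.2 (mem_univ y) (mem_univ y') ha hb hab
    have h2 := hPc.2 (mem_univ (x - y)) (mem_univ (x' - y')) ha hb hab
    have h3 : a • x + b • x' - (a • y + b • y') = a • (x - y) + b • (x' - y') := by module
    simp only [smul_eq_mul] at h1 h2 ⊢
    rw [h3]
    linarith
  · intro x y _; exact infConv_le hP hf x y
  · intro x e he
    obtain ⟨y, hy⟩ := infConv_lt (P := P) (f := f) x he
    exact ⟨y, mem_univ _, hy⟩
end

lemma convex_continuous {E : Type*} [NormedAddCommGroup E] [NormedSpace ℝ E]
    [FiniteDimensional ℝ E] {f : E → ℝ} (hf : ConvexOn ℝ univ f) : Continuous f :=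
  hf.locallyLipschitz.continuous

/-- convex property (tau) -/
def ConvTau {E : Type*} [AddCommGroup E] [Module ℝ E] [MeasurableSpace E]
    (m : Measure E) (P : E → ℝ) : Prop :=
  ∀ f : E → ℝ, ConvexOn ℝ univ f → (∀ x, 0 ≤ f x) →
    (∫⁻ x, ENNReal.ofReal (exp (infConv P f x)) ∂m) * (∫⁻ x, ENNReal.ofReal (exp (-f x)) ∂m) ≤ 1

set_option maxHeartbeats 1000000 in
lemma convTau_prod {E F : Type*} [NormedAddCommGroup E] [NormedSpace ℝ E] [FiniteDimensional ℝ E]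
    [MeasurableSpace E] [BorelSpace E]
    [NormedAddCommGroup F] [NormedSpace ℝ F] [FiniteDimensional ℝ F]
    [MeasurableSpace F] [BorelSpace F]
    (m : Measure E) [IsProbabilityMeasure m] (k : Measure F) [IsProbabilityMeasure k]
    (P : E → ℝ) (R : F → ℝ) (hP0 : ∀ x, 0 ≤ P x) (hR0 : ∀ x, 0 ≤ R x)
    (hPc : ConvexOn ℝ univ P) (hRc : ConvexOn ℝ univ R)
    (hm : ConvTau m P) (hk : ConvTau k R) :
    ConvTau (m.prod k) (fun z : E × F => P z.1 + R z.2) := by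
  intro f hf hf0
  have : SecondCountableTopology E := secondCountable_of_proper
  have : SecondCountableTopology F := secondCountable_of_proper
  have hfm : Measurable f := (convex_continuous hf).measurable
  have hfy : ∀ y, ConvexOn ℝ univ (fun x => f (x, y)) := by
    intro y
    refine ⟨convex_univ, fun x _ x' _ a b ha hb hab => ?_⟩
    have := hf.2 (mem_univ (x, y)) (mem_univ (x', y)) ha hb hab
    have h2 : a • (x, y) + b • (x', y) = (a • x + b • x', y) := by
      ext <;> simp [← add_smul, hab]
    rwa [h2] at this
  obtain ⟨q, hq⟩ : ∃ q : E × F → ℝ, ∀ z, q z = infConv P (fun x => f (x, z.2)) z.1 :=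
    ⟨_, fun z => rfl⟩
  have hq0 : ∀ z, 0 ≤ q z := fun z => by
    rw [hq]; exact infConv_nonneg hP0 (fun x => hf0 _) _
  have hqc : ConvexOn ℝ univ q := by
    refine convexOn_partial_min univ convex_univ
      (fun (z : E × F) x' => f (x', z.2) + P (z.1 - x')) _ ?_ ?_ ?_
    · rintro ⟨x, y⟩ ⟨x', y'⟩ w w' _ _ a b ha hb hab
      have h1 := hf.2 (mem_univ (w, y)) (mem_univ (w', y')) ha hb hab
      have h2 := hPc.2 (mem_univ (x - w)) (mem_univ (x' - w')) ha hb hab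
      have h3 : a • x + b • x' - (a • w + b • w') = a • (x - w) + b • (x' - w') := by module
      simp only [smul_eq_mul, Prod.smul_mk, Prod.mk_add_mk] at h1 h2 ⊢
      rw [h3]
      linarith
    · intro z y _; rw [hq]; exact infConv_le (f := fun x => f (x, z.2)) hP0 (fun x => hf0 _) z.1 y
    · intro z e he
      rw [hq]
      obtain ⟨y, hy⟩ := infConv_lt (P := P) (f := fun x => f (x, z.2)) z.1 he
      exact ⟨y, mem_univ _, hy⟩
  have hqm : Measurable q := (convex_continuous hqc).measurable
  obtain ⟨Z, hZ⟩ : ∃ Z : F → ENNReal, ∀ y, Z y = ∫⁻ x, ENNReal.ofReal (exp (q (x, y))) ∂m :=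
    ⟨_, fun y => rfl⟩
  obtain ⟨N, hN⟩ : ∃ N : F → ENNReal, ∀ y, N y = ∫⁻ x, ENNReal.ofReal (exp (-f (x, y))) ∂m :=
    ⟨_, fun y => rfl⟩
  have hZN : ∀ y, Z y * N y ≤ 1 := fun y => by
    rw [hZ, hN]
    simp only [hq]
    exact hm _ (hfy y) (fun x => hf0 _)
  have hN0 : ∀ y, N y ≠ 0 := by
    intro y h0
    have hme : Measurable fun x => ENNReal.ofReal (exp (-f (x, y))) := by fun_prop
    rw [hN] at h0
    rw [lintegral_eq_zero_iff hme] at h0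
    have : ∀ᵐ x ∂m, False := by
      filter_upwards [h0] with x hx
      have := exp_pos (-f (x, y))
      simp only [Pi.zero_apply, ENNReal.ofReal_eq_zero] at hx
      linarith
    simp at this
    exact IsProbabilityMeasure.ne_zero m this
  have hZtop : ∀ y, Z y ≠ ⊤ := by
    intro y h
    have := hZN y
    rw [h, ENNReal.top_mul (hN0 y)] at this
    simp at this
  have hZ1 : ∀ y, 1 ≤ Z y := by
    intro y
    calc (1 : ENNReal) = ∫⁻ x, 1 ∂m := by simp
      _ ≤ Z y := by
        rw [hZ]
        refine lintegral_mono fun x => ?_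
        rw [← ENNReal.ofReal_one]
        exact ENNReal.ofReal_le_ofReal (one_le_exp (hq0 _))
  obtain ⟨g, hg⟩ : ∃ g : F → ℝ, ∀ y, g y = log (Z y).toReal := ⟨_, fun y => rfl⟩
  have hZr1 : ∀ y, 1 ≤ (Z y).toReal := by
    intro y
    have := ENNReal.toReal_mono (hZtop y) (hZ1 y)
    simpa using this
  have hg0 : ∀ y, 0 ≤ g y := fun y => by
    rw [hg]; exact log_nonneg (hZr1 y)
  have hgZ : ∀ y, ENNReal.ofReal (exp (g y)) = Z y := by
    intro y
    rw [hg, exp_log (by linarith [hZr1 y]), ENNReal.ofReal_toReal (hZtop y)]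
  have hgc : ConvexOn ℝ univ g := by
    refine ⟨convex_univ, fun y _ y' _ a b ha hb hab => ?_⟩
    have key : Z (a • y + b • y') ≤ Z y ^ a * Z y' ^ b := by
      rw [hZ, hZ, hZ]
      refine le_trans (lintegral_mono fun x => ?_) (ENNReal.lintegral_mul_norm_pow_le
        (f := fun x => ENNReal.ofReal (exp (q (x, y))))
        (g := fun x => ENNReal.ofReal (exp (q (x, y'))))
        (by fun_prop) (by fun_prop) ha hb hab)
      have h1 := hqc.2 (mem_univ (x, y)) (mem_univ (x, y')) ha hb hab
      have h2 : a • (x, y) + b • (x, y') = (x, a • y + b • y') := by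
        ext <;> simp [← add_smul, hab]
      rw [h2] at h1
      rw [ENNReal.ofReal_rpow_of_pos (exp_pos _), ENNReal.ofReal_rpow_of_pos (exp_pos _),
        ← ENNReal.ofReal_mul (by positivity), ← exp_mul, ← exp_mul, ← exp_add]
      refine ENNReal.ofReal_le_ofReal (exp_le_exp.2 ?_)
      simp only [smul_eq_mul] at h1
      linarith
    have key2 : ENNReal.ofReal (exp (g (a • y + b • y'))) ≤
        ENNReal.ofReal (exp (a * g y + b * g y')) := by
      rw [hgZ]
      refine key.trans (le_of_eq ?_)
      rw [← hgZ y, ← hgZ y', ENNReal.ofReal_rpow_of_pos (exp_pos _),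
        ENNReal.ofReal_rpow_of_pos (exp_pos _),
        ← ENNReal.ofReal_mul (by positivity), ← exp_mul, ← exp_mul, ← exp_add]
      congr 2; ring
    rw [ENNReal.ofReal_le_ofReal_iff (exp_pos _).le, exp_le_exp] at key2
    simpa only [smul_eq_mul] using key2
  have hmain := hk g hgc hg0
  have hcv : ConvexOn ℝ univ (fun z : E × F => P z.1 + R z.2) := by
    refine ⟨convex_univ, fun x _ x' _ a b ha hb hab => ?_⟩
    have h1 := hPc.2 (mem_univ x.1) (mem_univ x'.1) ha hb hab
    have h2 := hRc.2 (mem_univ x.2) (mem_univ x'.2) ha hb hab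
    simp only [smul_eq_mul, Prod.fst_add, Prod.snd_add, Prod.smul_fst, Prod.smul_snd] at h1 h2 ⊢
    linarith
  have hPR0 : ∀ z : E × F, 0 ≤ P z.1 + R z.2 := fun z => add_nonneg (hP0 _) (hR0 _)
  have hQm : Measurable (infConv (fun z : E × F => P z.1 + R z.2) f) :=
    (convex_continuous (infConv_convex hPR0 hf0 hcv hf)).measurable
  refine le_trans (mul_le_mul' ?_ ?_) hmain
  · rw [lintegral_prod_symm' _ (by fun_prop)]
    refine lintegral_mono fun y => ?_
    have hb : ∀ y', ∫⁻ x, ENNReal.ofReal (exp (infConv (fun z : E × F => P z.1 + R z.2) f (x, y))) ∂m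
        ≤ ENNReal.ofReal (exp (g y' + R (y - y'))) := by
      intro y'
      rw [exp_add, ENNReal.ofReal_mul (exp_pos _).le, hgZ, hZ]
      rw [← lintegral_mul_const _ (by fun_prop)]
      refine lintegral_mono fun x => ?_
      rw [← ENNReal.ofReal_mul (exp_pos _).le, ← exp_add]
      refine ENNReal.ofReal_le_ofReal (exp_le_exp.2 ?_)
      rw [← sub_le_iff_le_add, hq]
      refine le_infConv _ _ fun x' => ?_
      have := infConv_le hPR0 hf0 (x, y) (x', y')
      simp only [Prod.mk_sub_mk] at this ⊢
      linarith
    have hfin : ∫⁻ x, ENNReal.ofReal (exp (infConv (fun z : E × F => P z.1 + R z.2) f (x, y))) ∂m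
        ≠ ⊤ := ne_top_of_le_ne_top ENNReal.ofReal_ne_top (hb y)
    rw [← ENNReal.ofReal_toReal hfin]
    set I := (∫⁻ x, ENNReal.ofReal (exp (infConv (fun z : E × F => P z.1 + R z.2) f (x, y))) ∂m).toReal
    refine ENNReal.ofReal_le_ofReal ?_
    rcases le_or_gt I 0 with hI | hI
    · exact hI.trans (exp_pos _).le
    · rw [← log_le_iff_le_exp hI]
      refine le_infConv _ _ fun y' => ?_
      rw [log_le_iff_le_exp hI]
      exact ENNReal.toReal_le_of_le_ofReal (exp_pos _).le (hb y')
  · rw [lintegral_prod_symm' _ (by fun_prop)]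
    refine lintegral_mono fun y => ?_
    have h1 := hZN y
    rw [hN] at h1
    rw [exp_neg, ENNReal.ofReal_inv_of_pos (exp_pos _), hgZ, ENNReal.le_inv_iff_mul_le]
    rw [mul_comm]
    exact h1

lemma convexOn_sum_phi {n : ℕ} {p : ℝ → ℝ} (hp : ConvexOn ℝ univ p) :
    ConvexOn ℝ univ (fun z : Fin n → ℝ => ∑ i, p (z i)) := by
  refine ⟨convex_univ, fun x _ x' _ a b ha hb hab => ?_⟩
  simp only [smul_eq_mul]
  rw [Finset.mul_sum, Finset.mul_sum, ← Finset.sum_add_distrib]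
  refine Finset.sum_le_sum fun i _ => ?_
  have := hp.2 (mem_univ (x i)) (mem_univ (x' i)) ha hb hab
  simpa using this

lemma convTau_pi {p : ℝ → ℝ} (hp0 : ∀ x, 0 ≤ p x) (hpc : ConvexOn ℝ univ p) :
    ∀ (n : ℕ) (μ : Fin n → Measure ℝ) [∀ i, IsProbabilityMeasure (μ i)],
      (∀ i, ConvTau (μ i) p) →
      ConvTau (Measure.pi μ) (fun z : Fin n → ℝ => ∑ i, p (z i)) := by
  intro n
  induction n with
  | zero =>
    intro μ _ _ f hf hf0
    have h1 : ∀ x, infConv (fun z : Fin 0 → ℝ => ∑ i, p (z i)) f x ≤ f 0 := by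
      intro x
      have := infConv_le (P := fun z : Fin 0 → ℝ => ∑ i, p (z i)) (f := f) (by simp) hf0 x 0
      simpa using this
    calc _ ≤ (∫⁻ x, ENNReal.ofReal (exp (f 0)) ∂(Measure.pi μ)) *
          (∫⁻ x, ENNReal.ofReal (exp (-f 0)) ∂(Measure.pi μ)) := by
          refine mul_le_mul' (lintegral_mono fun x => ?_) (lintegral_mono fun x => ?_)
          · exact ENNReal.ofReal_le_ofReal (exp_le_exp.2 (h1 x))
          · rw [Subsingleton.elim x 0]
      _ = 1 := by
        rw [lintegral_const, lintegral_const, measure_univ, mul_one, mul_one,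
          ← ENNReal.ofReal_mul (exp_pos _).le, ← exp_add]
        simp
  | succ n ih =>
    intro μ _ hμ f hf hf0
    have hsum0 : ∀ (k : ℕ) (z : Fin k → ℝ), 0 ≤ ∑ i, p (z i) :=
      fun k z => Finset.sum_nonneg fun i _ => hp0 _
    have hprod := convTau_prod (μ 0) (Measure.pi fun j : Fin n => μ j.succ) p
      (fun z : Fin n → ℝ => ∑ i, p (z i)) hp0 (hsum0 n) hpc (convexOn_sum_phi hpc) (hμ 0)
      (ih (fun j => μ j.succ) (fun j => hμ _))
    let e := Fin.consLinearEquiv ℝ (fun _ : Fin (n + 1) => ℝ)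
    have he : ∀ z, e z = Fin.cons z.1 z.2 := fun z => rfl
    have hf' : ConvexOn ℝ univ (fun z : ℝ × (Fin n → ℝ) => f (e z)) := by
      refine ⟨convex_univ, fun x _ x' _ r s hr hs hrs => ?_⟩
      have := hf.2 (mem_univ (e x)) (mem_univ (e x')) hr hs hrs
      simp only
      rw [map_add, map_smul, map_smul]
      exact this
    have hmain := hprod _ hf' (fun z => hf0 _)
    have hmp : MeasurePreserving (fun z => e z)
        ((μ 0).prod (Measure.pi fun j : Fin n => μ j.succ)) (Measure.pi μ) := by
      have := (measurePreserving_piFinSuccAbove μ 0).symm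
      have h2 : (fun z => e z) = ⇑(MeasurableEquiv.piFinSuccAbove (fun _ : Fin (n + 1) => ℝ) 0).symm := by
        funext z
        rw [he]
        simp [MeasurableEquiv.piFinSuccAbove_symm_apply, Fin.insertNthEquiv]
      rw [h2]
      exact this
    have hQ : ∀ z, infConv (fun z : Fin (n + 1) → ℝ => ∑ i, p (z i)) f (e z) =
        infConv (fun z : ℝ × (Fin n → ℝ) => p z.1 + ∑ i, p (z.2 i)) (fun z => f (e z)) z := by
      intro z
      unfold infConv
      refine (Equiv.iInf_congr e.toEquiv fun w => ?_).symm
      simp only [Fin.sum_univ_succ]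
      simp [he]
    have hmf : Measurable f := (convex_continuous hf).measurable
    have hmQ : Measurable (infConv (fun z : Fin (n + 1) → ℝ => ∑ i, p (z i)) f) :=
      (convex_continuous (infConv_convex (hsum0 _) hf0 (convexOn_sum_phi hpc) hf)).measurable
    rw [← hmp.lintegral_comp (by fun_prop), ← hmp.lintegral_comp (by fun_prop)]
    simp only [hQ]
    exact hmain

/-- the cost function -/
noncomputable def hub (a c : ℝ) : ℝ → ℝ := infConv (fun z => a * |z|) (fun w => c * w ^ 2)

section
variable {a c : ℝ}

lemma hub_le (ha : 0 ≤ a) (hc : 0 ≤ c) (z w : ℝ) : hub a c z ≤ c * w ^ 2 + a * |z - w| :=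
  infConv_le (P := fun z => a * |z|) (f := fun w => c * w ^ 2)
    (fun _ => by positivity) (fun _ => by positivity) z w

lemma hub_nonneg (ha : 0 ≤ a) (hc : 0 ≤ c) (z : ℝ) : 0 ≤ hub a c z :=
  infConv_nonneg (fun _ => by positivity) (fun _ => by positivity) z

lemma hub_lip (ha : 0 ≤ a) (hc : 0 ≤ c) (z w : ℝ) : hub a c z ≤ hub a c w + a * |z - w| := by
  rw [← sub_le_iff_le_add]
  refine le_infConv _ _ fun y => ?_
  have h1 := hub_le ha hc z y
  have h2 : a * |z - y| ≤ a * (|z - w| + |w - y|) :=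
    mul_le_mul_of_nonneg_left (abs_sub_le _ _ _) ha
  linarith

lemma convexOn_mul_abs (ha : 0 ≤ a) : ConvexOn ℝ univ (fun z : ℝ => a * |z|) := by
  have := (convexOn_univ_norm (E := ℝ)).smul ha
  simpa using this

lemma hub_convex (ha : 0 ≤ a) (hc : 0 ≤ c) : ConvexOn ℝ univ (hub a c) := by
  refine infConv_convex (fun _ => by positivity) (fun _ => by positivity)
    (convexOn_mul_abs ha) ?_
  have := ((even_two.convexOn_pow (𝕜 := ℝ))).smul hc
  simpa using this
end

lemma conc_of_tau {n : ℕ} (m : Measure (Fin n → ℝ)) [IsProbabilityMeasure m] {C t : ℝ}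
    (hC : 0 < C) (ht : 0 < t)
    (hm : ConvTau m (fun z : Fin n → ℝ => ∑ i, hub (1 / (2 * C)) (1 / (2 * C ^ 2)) (z i)))
    (A : Set (Fin n → ℝ)) (hA : Convex ℝ A)
    (hApos : 0 < m A) :
    1 - ENNReal.ofReal (Real.exp (-t)) / m A ≤
      m
        (A + {y : Fin n → ℝ | Real.sqrt (∑ i, (y i) ^ 2) ≤ Real.sqrt (2 * t) * C} +
          {z : Fin n → ℝ | (∑ i, |z i|) ≤ 2 * t * C}) := by
  set a := 1 / (2 * C) with ha_def
  set c := 1 / (2 * C ^ 2) with hc_def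
  have ha : 0 ≤ a := by positivity
  have hc : 0 ≤ c := by positivity
  obtain ⟨a0, ha0⟩ : A.Nonempty := nonempty_of_measure_ne_zero hApos.ne'
  have : Nonempty A := ⟨⟨a0, ha0⟩⟩
  obtain ⟨f, hf⟩ : ∃ f : (Fin n → ℝ) → ℝ, ∀ x, f x = ⨅ b : A, ∑ i, a * |x i - b.1 i| :=
    ⟨_, fun x => rfl⟩
  have hpos : ∀ x b : Fin n → ℝ, 0 ≤ ∑ i, a * |x i - b i| :=
    fun x b => Finset.sum_nonneg fun i _ => by positivity
  have hf1 : ∀ x, ∀ b ∈ A, f x ≤ ∑ i, a * |x i - b i| := by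
    intro x b hb
    rw [hf]
    exact ciInf_le ⟨0, by rintro _ ⟨y, rfl⟩; exact hpos _ _⟩ (⟨b, hb⟩ : A)
  have hf2 : ∀ x, ∀ e : ℝ, 0 < e → ∃ b ∈ A, ∑ i, a * |x i - b i| < f x + e := by
    intro x e he
    rw [hf]
    obtain ⟨b, hb⟩ := exists_lt_of_ciInf_lt
      (lt_add_of_pos_right (⨅ b : A, ∑ i, a * |x i - b.1 i|) he)
    exact ⟨b.1, b.2, hb⟩
  have hf0 : ∀ x, 0 ≤ f x := fun x => by rw [hf]; exact le_ciInf fun b => hpos _ _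
  have hfc : ConvexOn ℝ univ f := by
    refine convexOn_partial_min A hA (fun x b => ∑ i, a * |x i - b i|) f ?_ hf1 hf2
    intro x x' y y' _ _ s r hs hr hsr
    rw [Finset.mul_sum, Finset.mul_sum, ← Finset.sum_add_distrib]
    refine Finset.sum_le_sum fun i _ => ?_
    have h1 := (convexOn_mul_abs ha).2 (mem_univ (x i - y i)) (mem_univ (x' i - y' i)) hs hr hsr
    have h3 : (s • x + r • x') i - (s • y + r • y') i = s * (x i - y i) + r * (x' i - y' i) := by
      simp; ring
    rw [h3]
    simpa using h1
  have hmain := hm f hfc hf0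
  set P : (Fin n → ℝ) → ℝ := fun z => ∑ i, hub a c (z i) with hP
  have hP0 : ∀ z, 0 ≤ P z := fun z => Finset.sum_nonneg fun i _ => hub_nonneg ha hc _
  have hPc : ConvexOn ℝ univ P := convexOn_sum_phi (hub_convex ha hc)
  have hQm : Measurable (infConv P f) :=
    (convex_continuous (infConv_convex hP0 hf0 hPc hfc)).measurable
  have hN : m A ≤ ∫⁻ x, ENNReal.ofReal (exp (-f x)) ∂m := by
    have hfm : Measurable f := (convex_continuous hfc).measurable
    have := mul_meas_ge_le_lintegral (μ := m) (f := fun x => ENNReal.ofReal (exp (-f x)))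
      (by fun_prop) 1
    rw [one_mul] at this
    refine le_trans (measure_mono fun x hx => ?_) this
    have h0 : f x ≤ 0 := by simpa using hf1 x x hx
    simp only [mem_ofPred_eq]
    rw [← ENNReal.ofReal_one]
    exact ENNReal.ofReal_le_ofReal (one_le_exp (by linarith))
  set B := (A + {y : Fin n → ℝ | Real.sqrt (∑ i, (y i) ^ 2) ≤ Real.sqrt (2 * t) * C} +
          {z : Fin n → ℝ | (∑ i, |z i|) ≤ 2 * t * C}) with hB
  have hBc : ∀ x, x ∉ B → t ≤ infConv P f x := by
    intro x hx
    have h1 : ∀ b ∈ A, t ≤ P (x - b) := by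
      intro b hb
      by_contra hlt
      push Not at hlt
      apply hx
      set e := (t - P (x - b)) / (n + 1) with he
      have hepos : 0 < e := div_pos (by linarith) (by positivity)
      have hch : ∀ i, ∃ w : ℝ, c * w ^ 2 + a * |(x - b) i - w| < hub a c ((x - b) i) + e :=
        fun i => infConv_lt (P := fun z => a * |z|) (f := fun w => c * w ^ 2) _ hepos
      choose w hw using hch
      have hsum : ∑ i, (c * w i ^ 2 + a * |(x - b) i - w i|) ≤ t := by
        calc _ ≤ ∑ i, (hub a c ((x - b) i) + e) := Finset.sum_le_sum fun i _ => (hw i).le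
          _ = P (x - b) + n * e := by
            rw [Finset.sum_add_distrib]; simp [hP]
          _ ≤ P (x - b) + (n + 1) * e := by linarith
          _ = t := by rw [he]; field_simp; ring
      rw [Finset.sum_add_distrib, ← Finset.mul_sum, ← Finset.mul_sum] at hsum
      have hs1 : 0 ≤ ∑ i, w i ^ 2 := Finset.sum_nonneg fun i _ => sq_nonneg _
      have hs2 : 0 ≤ ∑ i, |(x - b) i - w i| := Finset.sum_nonneg fun i _ => abs_nonneg _
      refine ⟨b + w, ⟨b, hb, w, ?_, rfl⟩, x - b - w, ?_, by simp⟩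
      · simp only [mem_ofPred_eq]
        have h3 : c * ∑ i, w i ^ 2 ≤ t := by nlinarith
        rw [hc_def, div_mul_eq_mul_div, div_le_iff₀ (by positivity)] at h3
        refine Real.sqrt_le_iff.2 ⟨by positivity, ?_⟩
        rw [mul_pow, Real.sq_sqrt (by positivity)]
        linarith
      · simp only [mem_ofPred_eq]
        have h3 : a * ∑ i, |(x - b) i - w i| ≤ t := by nlinarith
        rw [ha_def, div_mul_eq_mul_div, div_le_iff₀ (by positivity)] at h3
        simp only [Pi.sub_apply] at h3 ⊢
        linarith
    refine le_infConv _ _ fun y => ?_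
    refine le_of_forall_pos_le_add fun e he => ?_
    obtain ⟨b, hb, hb'⟩ := hf2 y e he
    have h2 : P (x - b) ≤ P (x - y) + ∑ i, a * |y i - b i| := by
      simp only [hP]
      rw [← Finset.sum_add_distrib]
      refine Finset.sum_le_sum fun i _ => ?_
      have := hub_lip ha hc ((x - b) i) ((x - y) i)
      have h4 : (x - b) i - (x - y) i = y i - b i := by simp
      rwa [h4] at this
    have := h1 b hb
    linarith
  have hmB : m Bᶜ ≤ ENNReal.ofReal (exp (-t)) / m A := by
    have h1 := mul_meas_ge_le_lintegral (μ := m)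
      (f := fun x => ENNReal.ofReal (exp (infConv P f x))) (by fun_prop) (ENNReal.ofReal (exp t))
    have h2 : m Bᶜ ≤ m {x | ENNReal.ofReal (exp t) ≤ ENNReal.ofReal (exp (infConv P f x))} :=
      measure_mono fun x hx => ENNReal.ofReal_le_ofReal (exp_le_exp.2 (hBc x hx))
    have h3 : ENNReal.ofReal (exp t) * m Bᶜ * m A ≤ 1 :=
      (mul_le_mul' ((mul_le_mul' le_rfl h2).trans h1) hN).trans hmain
    rw [ENNReal.le_div_iff_mul_le (Or.inl hApos.ne') (Or.inl (measure_ne_top _ _))]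
    rw [exp_neg, ENNReal.ofReal_inv_of_pos (exp_pos _), ENNReal.le_inv_iff_mul_le]
    calc _ = ENNReal.ofReal (exp t) * m Bᶜ * m A := by ring
      _ ≤ 1 := h3
  rw [tsub_le_iff_right]
  calc (1 : ENNReal) = m univ := by simp
    _ = m (B ∪ Bᶜ) := by rw [union_compl_self]
    _ ≤ m B + m Bᶜ := measure_union_le _ _
    _ ≤ _ := by gcongr

lemma dom_lint (μ : Measure ℝ) {h l : ℝ}
    (htail : ∀ x : ℝ, 0 ≤ x → μ (Set.Ici (x + h)) ≤ ENNReal.ofReal l * μ (Set.Ici x))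
    {s : ℝ → ℝ} (hc : Continuous s) (hm : Monotone s) (h0 : ∀ x, 0 ≤ s x)
    (hz : ∀ x ≤ 0, s x = 0) :
    ∫⁻ x, ENNReal.ofReal (s (x - h)) ∂μ ≤ ENNReal.ofReal l * ∫⁻ x, ENNReal.ofReal (s x) ∂μ := by
  have hc' : Continuous fun x => s (x - h) := by fun_prop
  rw [lintegral_eq_lintegral_meas_le μ (Filter.Eventually.of_forall h0) hc.measurable.aemeasurable,
    lintegral_eq_lintegral_meas_le μ (f := fun x => s (x - h))
      (Filter.Eventually.of_forall fun x => h0 _) hc'.measurable.aemeasurable,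
    ← lintegral_const_mul' _ _ ENNReal.ofReal_ne_top]
  refine setLIntegral_mono' measurableSet_Ioi fun t ht => ?_
  have ht' : 0 < t := ht
  rcases Set.eq_empty_or_nonempty {a | t ≤ s a} with he | hne
  · have : {a | t ≤ s (a - h)} = ∅ := by
      ext x
      simp only [mem_ofPred_eq, mem_empty_iff_false, iff_false]
      intro hx
      have : x - h ∈ {a | t ≤ s a} := hx
      rw [he] at this
      exact this
    rw [this]; simp
  · have hcl : IsClosed {a | t ≤ s a} := isClosed_le continuous_const hc
    have hpos : ∀ x ∈ {a | t ≤ s a}, 0 ≤ x := by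
      intro x hx
      by_contra hneg
      push Not at hneg
      have h1 : t ≤ s x := hx
      rw [hz x hneg.le] at h1
      linarith
    have hbdd : BddBelow {a | t ≤ s a} := ⟨0, hpos⟩
    have hmem := hcl.csInf_mem hne hbdd
    set x0 := sInf {a | t ≤ s a} with hx0
    have hS : ∀ x, t ≤ s x ↔ x0 ≤ x := fun x =>
      ⟨fun hx => csInf_le hbdd hx, fun hx => le_trans hmem (hm hx)⟩
    have e1 : {a | t ≤ s a} = Ici x0 := by ext x; exact hS x
    have e2 : {a | t ≤ s (a - h)} = Ici (x0 + h) := by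
      ext x
      simp only [mem_ofPred_eq, mem_Ici, hS]
      exact le_sub_iff_add_le
    rw [e1, e2]
    exact htail x0 (hpos _ hmem)

lemma dom_int (μ : Measure ℝ) {h l : ℝ} (hh : 0 < h) (hl0 : 0 ≤ l)
    (htail : ∀ x : ℝ, 0 ≤ x → μ (Set.Ici (x + h)) ≤ ENNReal.ofReal l * μ (Set.Ici x))
    {s : ℝ → ℝ} (hc : Continuous s) (hm : Monotone s) (h0 : ∀ x, 0 ≤ s x)
    (hz : ∀ x ≤ 0, s x = 0) (hi : Integrable s μ) :
    Integrable (fun x => s (x - h)) μ ∧ ∫ x, s (x - h) ∂μ ≤ l * ∫ x, s x ∂μ := by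
  have hi' : Integrable (fun x => s (x - h)) μ := by
    refine hi.mono' (by fun_prop) (Filter.Eventually.of_forall fun x => ?_)
    rw [norm_of_nonneg (h0 _)]
    exact hm (by linarith)
  refine ⟨hi', ?_⟩
  have := dom_lint μ htail hc hm h0 hz
  rw [← ofReal_integral_eq_lintegral_ofReal hi (Filter.Eventually.of_forall h0),
    ← ofReal_integral_eq_lintegral_ofReal hi' (Filter.Eventually.of_forall fun x => h0 _),
    ← ENNReal.ofReal_mul hl0] at this
  exact (ENNReal.ofReal_le_ofReal_iff (mul_nonneg hl0 (integral_nonneg h0))).1 this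

lemma exp_moment (μ : Measure ℝ) [IsProbabilityMeasure μ] {h l a : ℝ} (hh : 0 < h) (hl0 : 0 ≤ l)
    (ha : 0 ≤ a) (hal : exp (a * h) * l < 1)
    (hsym : μ.map (fun x => -x) = μ)
    (htail : ∀ x : ℝ, 0 ≤ x → μ (Set.Ici (x + h)) ≤ ENNReal.ofReal l * μ (Set.Ici x)) :
    Integrable (fun x => exp (a * |x|)) μ := by
  obtain ⟨s, hs⟩ : ∃ s : ℝ → ℝ, ∀ x, s x = exp (a * max x 0) - 1 := ⟨_, fun x => rfl⟩
  have hsc : Continuous s := by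
    have : s = fun x => exp (a * max x 0) - 1 := funext hs
    rw [this]; fun_prop
  have hsm : Monotone s := by
    intro x y hxy
    rw [hs, hs]
    gcongr
  have hs0 : ∀ x, 0 ≤ s x := by
    intro x
    rw [hs]
    have : 1 ≤ exp (a * max x 0) := one_le_exp (by positivity)
    linarith
  have hsz : ∀ x ≤ 0, s x = 0 := by
    intro x hx; rw [hs, max_eq_right hx]; simp
  set r := exp (a * h) with hr
  have hr1 : 1 ≤ r := one_le_exp (by positivity)
  have hstep : ∀ x, s x ≤ r * s (x - h) + (r - 1) := by
    intro x
    have h1 : exp (a * max x 0) ≤ r * exp (a * max (x - h) 0) := by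
      rw [hr, ← exp_add, ← mul_add]
      gcongr
      refine max_le ?_ ?_
      · linarith [le_max_left (x - h) 0]
      · linarith [le_max_right (x - h) 0]
    rw [hs, hs]
    linarith
  have hbound : ∀ n : ℕ, ∫ x, min (s x) n ∂μ ≤ (r - 1) / (1 - r * l) := by
    intro n
    have hn : (0 : ℝ) ≤ n := Nat.cast_nonneg n
    have hci : Continuous fun x => min (s x) n := by fun_prop
    have hi : Integrable (fun x => min (s x) n) μ := by
      refine Integrable.of_bound (C := n) (by fun_prop) (Filter.Eventually.of_forall fun x => ?_)
      rw [norm_of_nonneg (le_min (hs0 _) hn)]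
      exact min_le_right _ _
    obtain ⟨hi2, hd⟩ := dom_int μ hh hl0 htail hci
      (fun x y hxy => min_le_min (hsm hxy) le_rfl) (fun x => le_min (hs0 _) hn)
      (fun x hx => by simp [hsz x hx]) hi
    have h1 : ∫ x, min (s x) n ∂μ ≤ ∫ x, (r * min (s (x - h)) n + (r - 1)) ∂μ := by
      refine integral_mono hi ((hi2.const_mul r).add (integrable_const _)) fun x => ?_
      simp only
      rcases le_total (s (x - h)) n with hx | hx
      · rw [min_eq_left hx]
        exact (min_le_left _ _).trans (hstep x)
      · rw [min_eq_right hx]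
        refine (min_le_right _ _).trans ?_
        nlinarith
    rw [integral_add (hi2.const_mul r) (integrable_const _), integral_const_mul] at h1
    simp only [integral_const, probReal_univ, one_smul] at h1
    rw [le_div_iff₀ (by linarith)]
    have := mul_le_mul_of_nonneg_left hd (by linarith : 0 ≤ r)
    linarith
  have hlint : ∫⁻ x, ENNReal.ofReal (s x) ∂μ ≤ ENNReal.ofReal ((r - 1) / (1 - r * l)) := by
    have hsup : ∀ x, ENNReal.ofReal (s x) = ⨆ n : ℕ, ENNReal.ofReal (min (s x) n) := by
      intro x
      refine le_antisymm ?_ (iSup_le fun n => ENNReal.ofReal_le_ofReal (min_le_left _ _))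
      obtain ⟨n, hn⟩ := exists_nat_ge (s x)
      refine le_trans ?_ (le_iSup _ n)
      rw [min_eq_left hn]
    simp only [hsup]
    rw [lintegral_iSup (fun n => by fun_prop)]
    · refine iSup_le fun n => ?_
      have hn : (0 : ℝ) ≤ n := Nat.cast_nonneg n
      have hi : Integrable (fun x => min (s x) n) μ := by
        refine Integrable.of_bound (C := n) (by fun_prop) (Filter.Eventually.of_forall fun x => ?_)
        rw [norm_of_nonneg (le_min (hs0 _) hn)]
        exact min_le_right _ _
      rw [← ofReal_integral_eq_lintegral_ofReal hi
        (Filter.Eventually.of_forall fun x => le_min (hs0 _) hn)]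
      exact ENNReal.ofReal_le_ofReal (hbound n)
    · intro n k hnk x
      refine ENNReal.ofReal_le_ofReal (min_le_min le_rfl ?_)
      exact_mod_cast hnk
  have hsi : Integrable s μ := by
    refine ⟨by fun_prop, ?_⟩
    rw [hasFiniteIntegral_iff_ofReal (Filter.Eventually.of_forall hs0)]
    exact hlint.trans_lt ENNReal.ofReal_lt_top
  have hsi2 : Integrable (fun x => s (-x)) μ := by
    have h1 : Integrable s (μ.map fun x => -x) := by rwa [hsym]
    exact h1.comp_measurable measurable_neg
  refine ((hsi.add hsi2).add (integrable_const 1)).mono' (by fun_prop)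
    (Filter.Eventually.of_forall fun x => ?_)
  rw [norm_of_nonneg (exp_pos _).le]
  simp only [Pi.add_apply]
  rcases le_total 0 x with hx | hx
  · rw [hsz (-x) (by linarith), hs, abs_of_nonneg hx, max_eq_left hx]; linarith
  · rw [hsz x hx, hs, abs_of_nonpos hx, max_eq_left (by linarith : 0 ≤ -x)]; linarith

lemma integral_sym (μ : Measure ℝ) (hsym : μ.map (fun x => -x) = μ) {F : ℝ → ℝ}
    (hF : Integrable F μ) :
    Integrable (fun x => F (-x)) μ ∧ ∫ x, F (-x) ∂μ = ∫ x, F x ∂μ := by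
  have h1 : Integrable F (μ.map fun x => -x) := by rwa [hsym]
  refine ⟨h1.comp_measurable measurable_neg, ?_⟩
  have := integral_map (μ := μ) measurable_neg.aemeasurable h1.aestronglyMeasurable
  rw [← this]
  congr 1

lemma hardy (μ : Measure ℝ) [IsProbabilityMeasure μ] {h l : ℝ} (hh : 0 < h) (hl0 : 0 ≤ l)
    (hl1 : l < 1)
    (htail : ∀ x : ℝ, 0 ≤ x → μ (Set.Ici (x + h)) ≤ ENNReal.ofReal l * μ (Set.Ici x))
    {G : ℝ → ℝ} (hc : Continuous G) (hm : Monotone G) (h0 : ∀ x, 0 ≤ G x)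
    (hz : ∀ x ≤ 0, G x = 0) (hlip : ∀ x, G x - G (x - h) ≤ (1 - l) ^ 2 / 34)
    (hint : Integrable (fun x => exp (G x)) μ) :
    Integrable (fun x => exp (G x - (34 / (1 - l) ^ 2 - 2) * (G x - G (x - h)) ^ 2)
      + exp (-G x) - 2) μ ∧
    Integrable (fun x => exp (G x) + exp (-G x) - 2) μ ∧
    ∫ x, (exp (G x - (34 / (1 - l) ^ 2 - 2) * (G x - G (x - h)) ^ 2) + exp (-G x) - 2) ∂μ +
      ∫ x, (exp (G x) + exp (-G x) - 2) ∂μ ≤ 0 := by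
  set d := 1 - l with hd
  have hd0 : 0 < d := by linarith
  have hd1 : d ≤ 1 := by linarith
  have hK : 0 ≤ 34 / d ^ 2 - 2 := by
    have : 34 ≤ 34 / d ^ 2 := by
      rw [le_div_iff₀ (by positivity)]; nlinarith
    linarith
  have hDnn : ∀ x, 0 ≤ G x - G (x - h) := fun x => by linarith [hm (by linarith : x - h ≤ x)]
  have hineg : Integrable (fun x => exp (-G x)) μ := by
    refine (integrable_const (1 : ℝ)).mono' (by fun_prop) (Filter.Eventually.of_forall fun x => ?_)
    rw [norm_of_nonneg (exp_pos _).le]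
    exact exp_le_one_iff.2 (by linarith [h0 x])
  have hik : Integrable (fun x => exp (G x - (34 / d ^ 2 - 2) * (G x - G (x - h)) ^ 2)) μ := by
    refine hint.mono' (by fun_prop) (Filter.Eventually.of_forall fun x => ?_)
    rw [norm_of_nonneg (exp_pos _).le]
    refine exp_le_exp.2 ?_
    have := mul_nonneg hK (sq_nonneg (G x - G (x - h)))
    linarith
  have hia := (hik.add hineg).sub (integrable_const (2 : ℝ))
  have hib := (hint.add hineg).sub (integrable_const (2 : ℝ))
  refine ⟨hia, hib, ?_⟩
  obtain ⟨S, hS⟩ : ∃ S : ℝ → ℝ, ∀ x, S x = exp (G x / 2) - exp (-(G x / 2)) := ⟨_, fun x => rfl⟩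
  have hSc : Continuous S := by
    have : S = fun x => exp (G x / 2) - exp (-(G x / 2)) := funext hS
    rw [this]; fun_prop
  have hS0 : ∀ x, 0 ≤ S x := by
    intro x
    rw [hS, sub_nonneg, exp_le_exp]
    linarith [h0 x]
  have hSm : Monotone S := by
    intro x y hxy
    rw [hS, hS]
    have h1 := hm hxy
    have h2 : exp (G x / 2) ≤ exp (G y / 2) := exp_le_exp.2 (by linarith)
    have h3 : exp (-(G y / 2)) ≤ exp (-(G x / 2)) := exp_le_exp.2 (by linarith)
    linarith
  have hSz : ∀ x ≤ 0, S x = 0 := fun x hx => by rw [hS, hz x hx]; simp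
  have hS2 : ∀ x, S x ^ 2 = exp (G x) + exp (-G x) - 2 := by
    intro x
    have e1 : exp (G x) = exp (G x / 2) ^ 2 := by rw [← exp_nat_mul]; congr 1; push_cast; ring
    have e2 : exp (-G x) = exp (-(G x / 2)) ^ 2 := by
      rw [← exp_nat_mul]; congr 1; push_cast; ring
    have e3 : exp (G x / 2) * exp (-(G x / 2)) = 1 := by rw [← exp_add]; simp
    rw [hS, e1, e2]
    linear_combination (-2) * e3
  have hiS : Integrable (fun x => S x ^ 2) μ := by
    simp only [hS2]; exact hib
  obtain ⟨hiS', hdom⟩ := dom_int μ hh hl0 htail (s := fun x => S x ^ 2) (by fun_prop)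
    (fun x y hxy => pow_le_pow_left₀ (hS0 x) (hSm hxy) 2) (fun x => sq_nonneg _)
    (fun x hx => by simp [hSz x hx]) hiS
  obtain ⟨V, hV⟩ : ∃ V : ℝ → ℝ, ∀ x, V x = exp (G x / 2) * (G x - G (x - h)) :=
    ⟨_, fun x => rfl⟩
  have hVc : Continuous V := by
    have : V = fun x => exp (G x / 2) * (G x - G (x - h)) := funext hV
    rw [this]; fun_prop
  have hV2 : ∀ x, V x ^ 2 = exp (G x) * (G x - G (x - h)) ^ 2 := by
    intro x
    have e1 : exp (G x) = exp (G x / 2) ^ 2 := by rw [← exp_nat_mul]; congr 1; push_cast; ring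
    rw [hV, e1]; ring
  have hd34 : d ^ 2 / 34 ≤ 1 := by nlinarith
  have hiV : Integrable (fun x => V x ^ 2) μ := by
    refine hint.mono' (by fun_prop) (Filter.Eventually.of_forall fun x => ?_)
    rw [norm_of_nonneg (sq_nonneg _), hV2]
    have h1 : (G x - G (x - h)) ^ 2 ≤ 1 := by
      have := hDnn x
      have := hlip x
      nlinarith
    exact mul_le_of_le_one_right (exp_pos _).le h1
  have hSV : ∀ x, S x ≤ S (x - h) + V x := by
    intro x
    rw [hS, hS, hV]
    set p := G x / 2 with hp
    set p' := G (x - h) / 2 with hp'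
    have hD : G x - G (x - h) = 2 * (p - p') := by rw [hp, hp']; ring
    have hpp : 0 ≤ p - p' := by have := hDnn x; linarith
    have hp0 : 0 ≤ p' := by have := h0 (x - h); linarith
    rw [hD]
    have h1 : exp p - exp p' ≤ exp p * (p - p') := by
      have h2 := add_one_le_exp (p' - p)
      have h3 : exp p' = exp p * exp (p' - p) := by rw [← exp_add]; congr 1; ring
      rw [h3]
      nlinarith [exp_pos p]
    have h4 : exp (-p') - exp (-p) ≤ exp p * (p - p') := by
      have h2 := add_one_le_exp (p' - p)
      have h3 : exp (-p) = exp (-p') * exp (p' - p) := by rw [← exp_add]; congr 1; ring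
      have h5 : exp (-p') ≤ exp p := exp_le_exp.2 (by linarith)
      rw [h3]
      have h6 : exp (-p') * (p - p') ≤ exp p * (p - p') := mul_le_mul_of_nonneg_right h5 hpp
      nlinarith [exp_pos (-p')]
    linarith
  have hSV2 : ∀ x, S x ^ 2 ≤ (1 + d / 2) * S (x - h) ^ 2 + (1 + 2 / d) * V x ^ 2 := by
    intro x
    have h1 : S x ^ 2 ≤ (S (x - h) + V x) ^ 2 := pow_le_pow_left₀ (hS0 x) (hSV x) 2
    have h2 : 2 * (S (x - h) * V x) ≤ d / 2 * S (x - h) ^ 2 + 2 / d * V x ^ 2 := by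
      have h3 : 0 ≤ (d * S (x - h) - 2 * V x) ^ 2 / (2 * d) := by positivity
      have h4 : (d * S (x - h) - 2 * V x) ^ 2 / (2 * d) =
        d / 2 * S (x - h) ^ 2 + 2 / d * V x ^ 2 - 2 * (S (x - h) * V x) := by
        field_simp; ring
      linarith
    nlinarith
  have hI1 : ∫ x, S x ^ 2 ∂μ ≤ (1 + d / 2) * ∫ x, S (x - h) ^ 2 ∂μ + (1 + 2 / d) * ∫ x, V x ^ 2 ∂μ := by
    rw [← integral_const_mul, ← integral_const_mul,
      ← integral_add (hiS'.const_mul _) (hiV.const_mul _)]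
    exact integral_mono hiS ((hiS'.const_mul _).add (hiV.const_mul _)) hSV2
  set IS := ∫ x, S x ^ 2 ∂μ with hIS
  set IV := ∫ x, V x ^ 2 ∂μ with hIV
  have hIS0 : 0 ≤ IS := integral_nonneg fun x => sq_nonneg _
  have hIV0 : 0 ≤ IV := integral_nonneg fun x => sq_nonneg _
  have hI2 : IS ≤ 6 / d ^ 2 * IV := by
    have h1 : (1 + d / 2) * ∫ x, S (x - h) ^ 2 ∂μ ≤ (1 + d / 2) * (l * IS) :=
      mul_le_mul_of_nonneg_left hdom (by positivity)
    have h2 : (1 + d / 2) * (l * IS) ≤ (1 - d / 2) * IS := by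
      have : l = 1 - d := by rw [hd]; ring
      rw [this]; nlinarith [mul_nonneg (mul_pos hd0 hd0).le hIS0]
    have h3 : d / 2 * IS ≤ (1 + 2 / d) * IV := by linarith
    have h4 : (1 + 2 / d) * IV ≤ (3 / d) * IV := by
      refine mul_le_mul_of_nonneg_right ?_ hIV0
      have : 1 ≤ 1 / d := by rw [le_div_iff₀ hd0]; linarith
      have e : 3 / d = 1 / d + 2 / d := by ring
      linarith
    have h5 : IS = 2 / d * (d / 2 * IS) := by field_simp
    rw [h5]
    calc 2 / d * (d / 2 * IS) ≤ 2 / d * (3 / d * IV) :=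
          mul_le_mul_of_nonneg_left (h3.trans h4) (by positivity)
      _ = 6 / d ^ 2 * IV := by field_simp; ring
  have hpt : ∀ x, exp (G x - (34 / d ^ 2 - 2) * (G x - G (x - h)) ^ 2) + exp (-G x) - 2 ≤
      S x ^ 2 - 16 / d ^ 2 * V x ^ 2 := by
    intro x
    rw [hS2, hV2]
    set D := G x - G (x - h) with hD
    have hDl : D ≤ d ^ 2 / 34 := hlip x
    have hD0 : 0 ≤ D := hDnn x
    set k := (34 / d ^ 2 - 2) * D ^ 2 with hk
    have hk0 : 0 ≤ k := mul_nonneg hK (sq_nonneg _)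
    have hk1 : k ≤ 1 := by
      have h1 : D ^ 2 ≤ (d ^ 2 / 34) * 1 := by nlinarith
      have h2 : k ≤ 34 / d ^ 2 * D ^ 2 := by rw [hk]; nlinarith [sq_nonneg D]
      calc k ≤ 34 / d ^ 2 * D ^ 2 := h2
        _ ≤ 34 / d ^ 2 * (d ^ 2 / 34 * 1) := mul_le_mul_of_nonneg_left h1 (by positivity)
        _ = 1 := by field_simp
    have hk16 : 16 / d ^ 2 * D ^ 2 ≤ k / 2 := by
      have h1 : 2 ≤ 2 / d ^ 2 := by rw [le_div_iff₀ (by positivity)]; nlinarith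
      have h2 : 34 / d ^ 2 = 2 * (16 / d ^ 2) + 2 / d ^ 2 := by ring
      rw [hk, h2]
      nlinarith [sq_nonneg D]
    have hek : exp (-k) ≤ 1 - k / 2 := by
      rw [exp_neg]
      have h1 := add_one_le_exp k
      rw [inv_le_iff_one_le_mul₀ (exp_pos _)]
      nlinarith
    have h7 : exp (G x - k) = exp (G x) * exp (-k) := by rw [← exp_add]; rfl
    have h8 : exp (G x) * exp (-k) ≤ exp (G x) * (1 - 16 / d ^ 2 * D ^ 2) :=
      mul_le_mul_of_nonneg_left (by linarith) (exp_pos _).le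
    rw [h7]
    linarith
  have hI3 : ∫ x, (exp (G x - (34 / d ^ 2 - 2) * (G x - G (x - h)) ^ 2) + exp (-G x) - 2) ∂μ ≤
      IS - 16 / d ^ 2 * IV := by
    rw [hIS, hIV, ← integral_const_mul, ← integral_sub hiS (hiV.const_mul _)]
    exact integral_mono hia (hiS.sub (hiV.const_mul _)) hpt
  have hI4 : ∫ x, (exp (G x) + exp (-G x) - 2) ∂μ = IS := by
    rw [hIS]; simp only [hS2]
  rw [hI4]
  have h9 : 0 ≤ 4 / d ^ 2 * IV := by positivity
  have h10 : 16 / d ^ 2 * IV = 2 * (6 / d ^ 2 * IV) + 4 / d ^ 2 * IV := by ring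
  linarith

/-- positive part of `g` on the right half line -/
noncomputable def sideG (g : ℝ → ℝ) (x : ℝ) : ℝ := max (g (max x 0)) 0

section
variable {g : ℝ → ℝ} {a : ℝ}

lemma sideG_nonneg (x : ℝ) : 0 ≤ sideG g x := le_max_right _ _

lemma sideG_zero (hg0 : g 0 = 0) {x : ℝ} (hx : x ≤ 0) : sideG g x = 0 := by
  simp [sideG, max_eq_right hx, hg0]

lemma sideG_mono (hgc : ConvexOn ℝ univ g) (hg0 : g 0 = 0) : Monotone (sideG g) := by
  intro x y hxy
  unfold sideG
  refine max_le ?_ (le_max_right _ _)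
  set x' := max x 0
  set y' := max y 0
  have h0 : 0 ≤ x' := le_max_right _ _
  have hxy' : x' ≤ y' := max_le_max hxy le_rfl
  rcases eq_or_lt_of_le (h0.trans hxy') with hy | hy
  · have : x' = 0 := by linarith
    rw [this, hg0]; exact le_max_right _ _
  · have hs : 0 ≤ x' / y' := by positivity
    have hs1 : x' / y' ≤ 1 := by rw [div_le_one hy]; exact hxy'
    have h1 := hgc.2 (mem_univ (0 : ℝ)) (mem_univ y') (by linarith : 0 ≤ 1 - x' / y') hs (by ring)
    have h2 : (1 - x' / y') • (0 : ℝ) + (x' / y') • y' = x' := by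
      simp only [smul_eq_mul]; field_simp; ring
    rw [h2, hg0] at h1
    simp only [smul_eq_mul, mul_zero, zero_add] at h1
    refine h1.trans ?_
    calc x' / y' * g y' ≤ x' / y' * max (g y') 0 := mul_le_mul_of_nonneg_left (le_max_left _ _) hs
      _ ≤ max (g y') 0 := mul_le_of_le_one_left (le_max_right _ _) hs1

lemma sideG_cont (hgc : Continuous g) : Continuous (sideG g) := by
  unfold sideG; fun_prop

lemma sideG_lip (ha : 0 ≤ a) (hl : ∀ x y, g x ≤ g y + a * |x - y|) (x : ℝ) {h : ℝ} (hh : 0 < h) :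
    sideG g x - sideG g (x - h) ≤ a * h := by
  unfold sideG
  have h1 := hl (max x 0) (max (x - h) 0)
  have h2 : |max x 0 - max (x - h) 0| ≤ h := by
    have := abs_max_sub_max_le_abs x (x - h) 0
    rw [sub_sub_cancel, abs_of_pos hh] at this
    exact this
  have h3 := mul_le_mul_of_nonneg_left h2 ha
  have h4 : 0 ≤ a * h := by positivity
  have h5 := le_max_left (g (max (x - h) 0)) 0
  have h6 := le_max_right (g (max (x - h) 0)) 0
  rw [sub_le_iff_le_add]
  refine max_le ?_ ?_ <;> linarith

lemma sideG_le (ha : 0 ≤ a) (hg0 : g 0 = 0) (hl : ∀ x y, g x ≤ g y + a * |x - y|) (x : ℝ) :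
    sideG g x ≤ a * |x| := by
  unfold sideG
  have h1 := hl (max x 0) 0
  have h2 : |max x 0 - 0| ≤ |x| := by
    rw [sub_zero, abs_of_nonneg (le_max_right _ _)]
    exact max_le (le_abs_self _) (abs_nonneg _)
  have h3 := mul_le_mul_of_nonneg_left h2 ha
  refine max_le ?_ (by positivity)
  rw [hg0] at h1
  linarith

lemma gain (hgc : ConvexOn ℝ univ g) (hg0 : g 0 = 0) {h d c : ℝ} (hh : 0 < h) (hd0 : 0 < d)
    (hc0 : 0 ≤ c)
    (hlip : ∀ x, sideG g x - sideG g (x - h) ≤ d ^ 2 / 34) (hc : c * h ^ 2 = d ^ 4 / 578)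
    {q : ℝ → ℝ} (hq : ∀ x z, q x ≤ g z + c * (x - z) ^ 2) {x : ℝ} (hx : 0 ≤ x) (hgx : 0 ≤ g x) :
    q x ≤ sideG g x - (34 / d ^ 2 - 2) * (sideG g x - sideG g (x - h)) ^ 2 := by
  have hD0 : 0 ≤ sideG g x - sideG g (x - h) := by
    linarith [sideG_mono hgc hg0 (by linarith : x - h ≤ x)]
  have hDl := hlip x
  set D := sideG g x - sideG g (x - h) with hD
  have hGx : sideG g x = g x := by unfold sideG; rw [max_eq_left hx, max_eq_left hgx]
  set y := max (x - h) 0 with hy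
  have hgy : g y ≤ sideG g (x - h) := le_max_left _ _
  have hxy0 : 0 ≤ x - y := by
    have : y ≤ x := max_le (by linarith) hx
    linarith
  have hxyh : x - y ≤ h := by linarith [le_max_left (x - h) 0]
  set θ := 34 * D / d ^ 2 with hθ
  have hθ0 : 0 ≤ θ := by positivity
  have hθ1 : θ ≤ 1 := by
    rw [hθ, div_le_one (by positivity)]
    linarith
  have h1 := hgc.2 (mem_univ x) (mem_univ y) (by linarith : 0 ≤ 1 - θ) hθ0 (by ring)
  simp only [smul_eq_mul] at h1
  have h2 := hq x ((1 - θ) * x + θ * y)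
  have h3 : c * (x - ((1 - θ) * x + θ * y)) ^ 2 ≤ 2 * D ^ 2 := by
    have e1 : x - ((1 - θ) * x + θ * y) = θ * (x - y) := by ring
    have e2 : (x - y) ^ 2 ≤ h ^ 2 := pow_le_pow_left₀ hxy0 hxyh 2
    rw [e1, mul_pow]
    calc c * (θ ^ 2 * (x - y) ^ 2) ≤ c * (θ ^ 2 * h ^ 2) := by gcongr
      _ = (c * h ^ 2) * θ ^ 2 := by ring
      _ = 2 * D ^ 2 := by rw [hc, hθ]; field_simp; ring
  have h4 : θ * g y ≤ θ * sideG g (x - h) := mul_le_mul_of_nonneg_left hgy hθ0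
  have h5 : θ * D = 34 / d ^ 2 * D ^ 2 := by rw [hθ]; ring
  have h6 : θ * D = θ * g x - θ * sideG g (x - h) := by rw [hD, hGx]; ring
  rw [hGx]
  linarith

lemma pointR (hgc : ConvexOn ℝ univ g) (hg0 : g 0 = 0) {h d c : ℝ} (hh : 0 < h) (hd0 : 0 < d)
    (hc0 : 0 ≤ c)
    (hlip : ∀ x, sideG g x - sideG g (x - h) ≤ d ^ 2 / 34) (hc : c * h ^ 2 = d ^ 4 / 578)
    {q : ℝ → ℝ} (hq : ∀ x z, q x ≤ g z + c * (x - z) ^ 2) {x : ℝ} (hx : 0 ≤ x) :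
    exp (q x) + exp (-g x) - 2 ≤
      (exp (sideG g x - (34 / d ^ 2 - 2) * (sideG g x - sideG g (x - h)) ^ 2)
        + exp (-sideG g x) - 2) +
      (exp (sideG (fun y => g (-y)) x) + exp (-sideG (fun y => g (-y)) x) - 2) := by
  have hcosh : ∀ s : ℝ, exp s + exp (-s) - 2 = 2 * cosh s - 2 := fun s => by
    rw [cosh_eq]; ring
  rcases le_or_gt 0 (g x) with hgx | hgx
  · have h1 := gain hgc hg0 hh hd0 hc0 hlip hc hq hx hgx
    have hGx : sideG g x = g x := by unfold sideG; rw [max_eq_left hx, max_eq_left hgx]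
    have h2 := exp_le_exp.2 h1
    have h3 : exp (-g x) = exp (-sideG g x) := by rw [hGx]
    rw [hcosh (sideG (fun y => g (-y)) x)]
    have h4 := one_le_cosh (sideG (fun y => g (-y)) x)
    linarith
  · have hGx : sideG g x = 0 := by unfold sideG; rw [max_eq_left hx, max_eq_right hgx.le]
    have hGx' : sideG g (x - h) = 0 := by
      refine le_antisymm ?_ (sideG_nonneg _)
      rw [← hGx]
      exact sideG_mono hgc hg0 (by linarith)
    have h1 : q x ≤ g x := by simpa using hq x x
    have h2 : -g x ≤ g (-x) := by
      have := hgc.2 (mem_univ x) (mem_univ (-x)) (by norm_num : (0 : ℝ) ≤ 1 / 2)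
        (by norm_num : (0 : ℝ) ≤ 1 / 2) (by norm_num)
      simp only [smul_eq_mul] at this
      have e : 1 / 2 * x + 1 / 2 * -x = 0 := by ring
      rw [e, hg0] at this
      linarith
    have h3 : |g x| ≤ |sideG (fun y => g (-y)) x| := by
      rw [abs_of_neg hgx, abs_of_nonneg (sideG_nonneg _)]
      refine h2.trans ?_
      unfold sideG
      rw [max_eq_left hx]
      exact le_max_left _ _
    have h4 := cosh_le_cosh.2 h3
    rw [hGx, hGx', hcosh (sideG (fun y => g (-y)) x)]
    have h5 := hcosh (g x)
    have h6 := exp_le_exp.2 h1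
    simp
    linarith

lemma alpha_zero (hg0 : g 0 = 0) {h d : ℝ} (hh : 0 < h) {x : ℝ} (hx : x ≤ 0) :
    exp (sideG g x - (34 / d ^ 2 - 2) * (sideG g x - sideG g (x - h)) ^ 2)
        + exp (-sideG g x) - 2 = 0 := by
  rw [sideG_zero hg0 hx, sideG_zero hg0 (by linarith : x - h ≤ 0)]
  norm_num

lemma beta_zero (hg0 : g 0 = 0) {x : ℝ} (hx : x ≤ 0) :
    exp (sideG g x) + exp (-sideG g x) - 2 = 0 := by
  rw [sideG_zero hg0 hx]
  norm_num
end

lemma core (μ : Measure ℝ) [IsProbabilityMeasure μ] {h l a c : ℝ} (hh : 0 < h) (hl0 : 0 ≤ l)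
    (hl1 : l < 1) (hsym : μ.map (fun x => -x) = μ)
    (htail : ∀ x : ℝ, 0 ≤ x → μ (Set.Ici (x + h)) ≤ ENNReal.ofReal l * μ (Set.Ici x))
    (ha0 : 0 ≤ a) (hc0 : 0 ≤ c) (ha : a * h = (1 - l) ^ 2 / 34)
    (hc : c * h ^ 2 = (1 - l) ^ 4 / 578)
    {g q : ℝ → ℝ} (hgc : ConvexOn ℝ univ g) (hg0 : g 0 = 0)
    (hgl : ∀ x y, g x ≤ g y + a * |x - y|) (hqm : Measurable q)
    (hq : ∀ x z, q x ≤ g z + c * (x - z) ^ 2) :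
    Integrable (fun x => exp (q x)) μ ∧ Integrable (fun x => exp (-g x)) μ ∧
      ∫ x, exp (q x) ∂μ + ∫ x, exp (-g x) ∂μ ≤ 2 := by
  have hd0 : 0 < 1 - l := by linarith
  have hmom : Integrable (fun x => exp (a * |x|)) μ := by
    refine exp_moment μ hh hl0 ha0 ?_ hsym htail
    rw [ha]
    have h1 : l ≤ exp (-(1 - l)) := by linarith [add_one_le_exp (-(1 - l))]
    calc exp ((1 - l) ^ 2 / 34) * l ≤ exp ((1 - l) ^ 2 / 34) * exp (-(1 - l)) :=
          mul_le_mul_of_nonneg_left h1 (exp_pos _).le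
      _ = exp ((1 - l) ^ 2 / 34 + -(1 - l)) := by rw [exp_add]
      _ < 1 := by
        rw [exp_lt_one_iff]
        nlinarith
  have hgcont : Continuous g := convex_continuous hgc
  set w : ℝ → ℝ := fun y => g (-y) with hw
  have hwc : ConvexOn ℝ univ w := by
    refine ⟨convex_univ, fun x _ y _ s t hs ht hst => ?_⟩
    have := hgc.2 (mem_univ (-x)) (mem_univ (-y)) hs ht hst
    have e : s • -x + t • -y = -(s • x + t • y) := by module
    rw [e] at this
    exact this
  have hw0 : w 0 = 0 := by simp [hw, hg0]
  have hwl : ∀ x y, w x ≤ w y + a * |x - y| := by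
    intro x y
    have := hgl (-x) (-y)
    have e : |-x - -y| = |x - y| := by rw [← abs_neg]; congr 1; ring
    rwa [e] at this
  have hwg : (fun y => w (-y)) = g := by funext y; simp [hw]
  have side : ∀ u : ℝ → ℝ, ConvexOn ℝ univ u → u 0 = 0 → (∀ x y, u x ≤ u y + a * |x - y|) →
      (∀ x, sideG u x - sideG u (x - h) ≤ (1 - l) ^ 2 / 34) ∧
      Integrable (fun x => exp (sideG u x)) μ := by
    intro u huc hu0 hul
    refine ⟨fun x => by rw [← ha]; exact sideG_lip ha0 hul x hh, ?_⟩
    have hcont := sideG_cont (convex_continuous huc)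
    refine hmom.mono' (by fun_prop) (Filter.Eventually.of_forall fun x => ?_)
    rw [norm_of_nonneg (exp_pos _).le]
    exact exp_le_exp.2 (sideG_le ha0 hu0 hul x)
  obtain ⟨hlu, hiu⟩ := side g hgc hg0 hgl
  obtain ⟨hlw, hiw⟩ := side w hwc hw0 hwl
  obtain ⟨au, bu, hu⟩ := hardy μ hh hl0 hl1 htail (sideG_cont hgcont) (sideG_mono hgc hg0)
    sideG_nonneg (fun x hx => sideG_zero hg0 hx) hlu hiu
  obtain ⟨aw, bw, hw'⟩ := hardy μ hh hl0 hl1 htail (sideG_cont (convex_continuous hwc))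
    (sideG_mono hwc hw0) sideG_nonneg (fun x hx => sideG_zero hw0 hx) hlw hiw
  obtain ⟨aw', eaw⟩ := integral_sym μ hsym aw
  obtain ⟨bu', ebu⟩ := integral_sym μ hsym bu
  have hiq : Integrable (fun x => exp (q x)) μ := by
    refine hmom.mono' (by fun_prop) (Filter.Eventually.of_forall fun x => ?_)
    rw [norm_of_nonneg (exp_pos _).le]
    refine exp_le_exp.2 ?_
    have h1 := hq x x
    have h2 := hgl x 0
    simp only [sub_self, sub_zero, hg0] at h1 h2
    linarith
  have hig : Integrable (fun x => exp (-g x)) μ := by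
    refine hmom.mono' (by fun_prop) (Filter.Eventually.of_forall fun x => ?_)
    rw [norm_of_nonneg (exp_pos _).le]
    refine exp_le_exp.2 ?_
    have h2 := hgl 0 x
    rw [hg0, zero_sub, abs_neg] at h2
    linarith
  refine ⟨hiq, hig, ?_⟩
  have hR := (hiq.add hig).sub (integrable_const (2 : ℝ))
  have hqw : ∀ x z, (fun y => q (-y)) x ≤ w z + c * (x - z) ^ 2 := by
    intro x z
    have := hq (-x) (-z)
    have e : (-x - -z) ^ 2 = (x - z) ^ 2 := by ring
    rwa [e] at this
  have key := integral_mono hR ((au.add bw).add (aw'.add bu')) (fun x => by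
    simp only [Pi.add_apply, Pi.sub_apply]
    rcases le_total 0 x with hx | hx
    · have h1 := pointR hgc hg0 hh hd0 hc0 hlu hc hq hx
      have h2 := alpha_zero (g := w) hw0 (d := 1 - l) hh (by linarith : -x ≤ 0)
      have h3 := beta_zero (g := g) hg0 (by linarith : -x ≤ 0)
      linarith
    · have h1 := pointR hwc hw0 hh hd0 hc0 hlw hc hqw (by linarith : 0 ≤ -x)
      rw [hwg] at h1
      have h2 := alpha_zero (g := g) hg0 (d := 1 - l) hh hx
      have h3 := beta_zero (g := w) hw0 hx
      have e1 : w (-x) = g x := by simp [hw]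
      simp only [neg_neg] at h1
      rw [e1] at h1
      linarith)
  rw [integral_sub' (hiq.add hig) (integrable_const _), integral_add' hiq hig,
    integral_add' (au.add bw) (aw'.add bu'), integral_add' au bw, integral_add' aw' bu',
    eaw, ebu] at key
  simp only [integral_const, probReal_univ, one_smul] at key
  linarith

lemma convTau_one (μ : Measure ℝ) [IsProbabilityMeasure μ] {h l C : ℝ} (hh : 0 < h) (hl0 : 0 ≤ l)
    (hl1 : l < 1) (hsym : μ.map (fun x => -x) = μ)
    (htail : ∀ x : ℝ, 0 ≤ x → μ (Set.Ici (x + h)) ≤ ENNReal.ofReal l * μ (Set.Ici x))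
    (hC : C = 17 * h / (1 - l) ^ 2) :
    ConvTau μ (hub (1 / (2 * C)) (1 / (2 * C ^ 2))) := by
  have hd0 : 0 < 1 - l := by linarith
  have hC0 : 0 < C := by rw [hC]; positivity
  obtain ⟨a, ha⟩ : ∃ a, a = 1 / (2 * C) := ⟨_, rfl⟩
  obtain ⟨c, hc⟩ : ∃ c, c = 1 / (2 * C ^ 2) := ⟨_, rfl⟩
  rw [← ha, ← hc]
  have ha0 : 0 ≤ a := by rw [ha]; positivity
  have hc0 : 0 ≤ c := by rw [hc]; positivity
  have hah : a * h = (1 - l) ^ 2 / 34 := by rw [ha, hC]; field_simp; norm_num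
  have hch : c * h ^ 2 = (1 - l) ^ 4 / 578 := by rw [hc, hC]; field_simp; norm_num
  intro f hf hf0
  have hP0 : ∀ z : ℝ, 0 ≤ a * |z| := fun z => by positivity
  obtain ⟨g1, hg1⟩ : ∃ g1, g1 = infConv (fun z : ℝ => a * |z|) f := ⟨_, rfl⟩
  have hg1c : ConvexOn ℝ univ g1 := by
    rw [hg1]; exact infConv_convex hP0 hf0 (convexOn_mul_abs ha0) hf
  have hg1l : ∀ x y, g1 x ≤ g1 y + a * |x - y| := by
    intro x y
    rw [← sub_le_iff_le_add]
    rw [hg1]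
    refine le_infConv _ _ fun z => ?_
    have h1 := infConv_le (P := fun z : ℝ => a * |z|) hP0 hf0 x z
    have h2 : a * |x - z| ≤ a * (|x - y| + |y - z|) :=
      mul_le_mul_of_nonneg_left (abs_sub_le _ _ _) ha0
    linarith
  have hg1f : ∀ x, g1 x ≤ f x := by
    intro x
    have h1 := infConv_le (P := fun z : ℝ => a * |z|) hP0 hf0 x x
    rw [hg1]
    simpa using h1
  have hQ : ∀ x z, infConv (hub a c) f x ≤ g1 z + c * (x - z) ^ 2 := by
    intro x z
    rw [← sub_le_iff_le_add, hg1]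
    refine le_infConv _ _ fun y => ?_
    have h1 := infConv_le (P := hub a c) (hub_nonneg ha0 hc0) hf0 x y
    have h2 := hub_le ha0 hc0 (x - y) (x - z)
    have e : x - y - (x - z) = z - y := by ring
    rw [e] at h2
    linarith
  have hQm : Measurable (infConv (hub a c) f) :=
    (convex_continuous (infConv_convex (hub_nonneg ha0 hc0) hf0 (hub_convex ha0 hc0) hf)).measurable
  obtain ⟨i1, i2, hle⟩ := core μ hh hl0 hl1 hsym htail ha0 hc0 hah hch
    (g := fun x => g1 x - g1 0) (q := fun x => infConv (hub a c) f x - g1 0)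
    (hg1c.add_const (-g1 0)) (by simp)
    (fun x y => by have := hg1l x y; linarith) (hQm.sub_const _)
    (fun x z => by have := hQ x z; linarith)
  set p := ∫ x, exp (infConv (hub a c) f x - g1 0) ∂μ with hp
  set r := ∫ x, exp (-(g1 x - g1 0)) ∂μ with hr
  have hp0 : 0 ≤ p := integral_nonneg fun x => (exp_pos _).le
  have hr0 : 0 ≤ r := integral_nonneg fun x => (exp_pos _).le
  have hpr : p * r ≤ 1 := by nlinarith [sq_nonneg (p - r)]
  have e1 : ∫⁻ x, ENNReal.ofReal (exp (infConv (hub a c) f x)) ∂μ =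
      ENNReal.ofReal (exp (g1 0)) * ENNReal.ofReal p := by
    rw [hp, ofReal_integral_eq_lintegral_ofReal i1
      (Filter.Eventually.of_forall fun x => (exp_pos _).le),
      ← lintegral_const_mul' _ _ ENNReal.ofReal_ne_top]
    refine lintegral_congr fun x => ?_
    rw [← ENNReal.ofReal_mul (exp_pos _).le, ← exp_add]
    congr 2; ring
  have e2 : ∫⁻ x, ENNReal.ofReal (exp (-f x)) ∂μ ≤
      ENNReal.ofReal (exp (-g1 0)) * ENNReal.ofReal r := by
    rw [hr, ofReal_integral_eq_lintegral_ofReal i2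
      (Filter.Eventually.of_forall fun x => (exp_pos _).le),
      ← lintegral_const_mul' _ _ ENNReal.ofReal_ne_top]
    refine lintegral_mono fun x => ?_
    rw [← ENNReal.ofReal_mul (exp_pos _).le, ← exp_add]
    refine ENNReal.ofReal_le_ofReal (exp_le_exp.2 ?_)
    linarith [hg1f x]
  calc _ ≤ (ENNReal.ofReal (exp (g1 0)) * ENNReal.ofReal p) *
        (ENNReal.ofReal (exp (-g1 0)) * ENNReal.ofReal r) := mul_le_mul' e1.le e2
    _ = ENNReal.ofReal (exp (g1 0) * exp (-g1 0)) * ENNReal.ofReal (p * r) := by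
      rw [ENNReal.ofReal_mul (exp_pos _).le, ENNReal.ofReal_mul hp0]; ring
    _ ≤ 1 := by
      rw [← exp_add]
      simpa using hpr

theorem stmt13 (n : ℕ) (μ : Fin n → Measure ℝ) [∀ i, IsProbabilityMeasure (μ i)]
    (h l : ℝ) (hh : 0 < h) (hl0 : 0 ≤ l) (hl1 : l < 1)
    (hsym : ∀ i, (μ i).map (fun x => -x) = μ i)
    (htail : ∀ i, ∀ x : ℝ, 0 ≤ x →
      (μ i) (Set.Ici (x + h)) ≤ ENNReal.ofReal l * (μ i) (Set.Ici x))
    (Cτ : ℝ) (hCτ : Cτ = 17 * h / (1 - l) ^ 2)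
    (A : Set (Fin n → ℝ)) (hA : Convex ℝ A) (hAm : MeasurableSet A)
    (hApos : 0 < Measure.pi μ A) (t : ℝ) (ht : 0 < t) :
    1 - ENNReal.ofReal (Real.exp (-t)) / Measure.pi μ A ≤
      Measure.pi μ
        (A + {y : Fin n → ℝ | Real.sqrt (∑ i, (y i) ^ 2) ≤ Real.sqrt (2 * t) * Cτ} +
          {z : Fin n → ℝ | (∑ i, |z i|) ≤ 2 * t * Cτ}) := by
  have hd0 : 0 < 1 - l := by linarith
  have hC0 : 0 < Cτ := by rw [hCτ]; positivity
  have ha0 : 0 ≤ 1 / (2 * Cτ) := by positivity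
  have hc0 : 0 ≤ 1 / (2 * Cτ ^ 2) := by positivity
  exact conc_of_tau (Measure.pi μ) hC0 ht
    (convTau_pi (hub_nonneg ha0 hc0) (hub_convex ha0 hc0) n μ
      (fun i => convTau_one (μ i) hh hl0 hl1 (hsym i) (htail i) hCτ)) A hA hApos
end

section
/- Let μ = μ₁⊗⋯⊗μₙ with each μᵢ ∈ M(h,λ), and C_τ = 17h/(1−λ)². Let f: ℝⁿ → ℝ be convex with |f(x)−f(y)| ≤ a|x−y|₂ and |f(x)−f(y)| ≤ b|x−y|₁ for all x,y. Then μ({f > med_μ f + C_τ·t}) ≤ 2exp(−(1/8)min{t/b, t²/a²}) for all t ≥ 0. -/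
open MeasureTheory Set Real

lemma shift_le (μ : Measure ℝ) [IsProbabilityMeasure μ] (h l : ℝ)
    (htail : ∀ x : ℝ, 0 ≤ x → μ (Set.Ici (x + h)) ≤ ENNReal.ofReal l * μ (Set.Ici x))
    (V : ℝ → ℝ) (hm : Monotone V) (hc : Continuous V) (hV0 : ∀ x, x ≤ 0 → V x = 0)
    (hpos : ∀ x, 0 ≤ V x) :
    ∫⁻ x, ENNReal.ofReal (V (x - h)) ∂μ ≤ ENNReal.ofReal l * ∫⁻ x, ENNReal.ofReal (V x) ∂μ := by
  have hc' : Continuous (fun x => V (x - h)) := by fun_prop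
  rw [lintegral_eq_lintegral_meas_le μ (Filter.Eventually.of_forall fun x => hpos (x - h)) hc'.aemeasurable,
    lintegral_eq_lintegral_meas_le μ (Filter.Eventually.of_forall hpos) hc.aemeasurable,
    ← lintegral_const_mul' _ _ ENNReal.ofReal_ne_top]
  refine setLIntegral_mono' measurableSet_Ioi fun t ht => ?_
  have ht : 0 < t := ht
  rcases Set.eq_empty_or_nonempty {a | t ≤ V a} with he | hne
  · have : {a | t ≤ V (a - h)} = ∅ := by
      ext a
      simp only [mem_ofPred_eq, mem_empty_iff_false, iff_false]
      intro ha
      have : a - h ∈ {a | t ≤ V a} := ha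
      rw [he] at this; exact this
    rw [this]; simp
  · have hbdd : BddBelow {a | t ≤ V a} := ⟨0, fun a ha => by
      by_contra hlt
      have := hV0 a (le_of_lt (not_le.mp hlt))
      have ha : t ≤ V a := ha
      linarith⟩
    have hcl : IsClosed {a | t ≤ V a} := isClosed_le continuous_const hc
    have hmem := hcl.csInf_mem hne hbdd
    set c := sInf {a | t ≤ V a} with hcdef
    have hmem' : t ≤ V c := hmem
    have hiff : ∀ a, t ≤ V a ↔ c ≤ a := fun a =>
      ⟨fun ha => csInf_le hbdd ha, fun ha => hmem'.trans (hm ha)⟩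
    have hc0 : 0 ≤ c := by
      by_contra hlt
      have := hV0 c (le_of_lt (not_le.mp hlt))
      linarith
    have e1 : {a | t ≤ V (a - h)} = Ici (c + h) := by
      ext a; simp only [mem_ofPred_eq, hiff, mem_Ici]; constructor <;> intro _ <;> linarith
    have e2 : {a | t ≤ V a} = Ici c := by
      ext a; simp only [mem_ofPred_eq, hiff, mem_Ici]
    rw [e1, e2]; exact htail c hc0

lemma cosh_tangent (a b : ℝ) (hb : 0 ≤ b) (hab : b ≤ a) :
    cosh a - cosh b ≤ sinh a * (a - b) := by
  have e1 := Real.add_one_le_exp (b - a)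
  have e2 := Real.add_one_le_exp (a - b)
  have h1 : exp b = exp a * exp (b - a) := by rw [← exp_add]; ring_nf
  have h2 : exp (-b) = exp (-a) * exp (a - b) := by rw [← exp_add]; ring_nf
  rw [cosh_eq, cosh_eq, sinh_eq, h1, h2]
  nlinarith [exp_pos a, exp_pos (-a), mul_le_mul_of_nonneg_left e1 (exp_pos a).le,
    mul_le_mul_of_nonneg_left e2 (exp_pos (-a)).le]

/-- pointwise inequality for `W = 2 cosh u - 2`. -/
lemma W_step (a b e : ℝ) (hb : 0 ≤ b) (hab : b ≤ a) (he : 0 < e) :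
    (1 - e / 2) * (2 * cosh a - 2) ≤ (2 * cosh b - 2) + 2 / e * (exp a * (a - b) ^ 2) := by
  have h1 := cosh_tangent a b hb hab
  have hca := one_le_cosh a
  have hs : sinh a ^ 2 = (cosh a - 1) * (cosh a + 1) := by
    have := cosh_sq a; nlinarith
  have h2 : cosh a + 1 ≤ 2 * exp a := by
    have h3 : exp (-a) ≤ exp a := exp_le_exp.mpr (by linarith)
    have h4 : 1 ≤ exp a := one_le_exp (by linarith)
    rw [cosh_eq]; linarith
  -- 2 sinh a d ≤ e (cosh a - 1) + (cosh a + 1) d^2 / e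
  have h5 : 2 * (sinh a * (a - b)) ≤ e * (cosh a - 1) + 2 / e * (exp a * (a - b) ^ 2) := by
    have h6 : 2 * (sinh a * (a - b)) ≤ e * (cosh a - 1) + 1 / e * ((cosh a + 1) * (a - b) ^ 2) := by
      have hA : 0 ≤ e * (cosh a - 1) := by nlinarith
      have hB : 0 ≤ 1 / e * ((cosh a + 1) * (a - b) ^ 2) := by positivity
      apply le_of_sq_le_sq _ (by positivity)
      have : (2 * (sinh a * (a - b))) ^ 2 = 4 * (e * (cosh a - 1)) * (1 / e * ((cosh a + 1) * (a - b) ^ 2)) := by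
        field_simp
        rw [hs]; ring
      rw [this]
      nlinarith [sq_nonneg (e * (cosh a - 1) - 1 / e * ((cosh a + 1) * (a - b) ^ 2))]
    have h7 : 1 / e * ((cosh a + 1) * (a - b) ^ 2) ≤ 2 / e * (exp a * (a - b) ^ 2) := by
      have : 2 / e * (exp a * (a - b) ^ 2) = 1 / e * ((2 * exp a) * (a - b) ^ 2) := by ring
      rw [this]
      gcongr
    linarith
  linarith

lemma shift_real (μ : Measure ℝ) [IsProbabilityMeasure μ] (h l : ℝ) (hl0 : 0 ≤ l)
    (htail : ∀ x : ℝ, 0 ≤ x → μ (Set.Ici (x + h)) ≤ ENNReal.ofReal l * μ (Set.Ici x))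
    (V : ℝ → ℝ) (hm : Monotone V) (hc : Continuous V) (hV0 : ∀ x, x ≤ 0 → V x = 0)
    (hpos : ∀ x, 0 ≤ V x) (hi : Integrable V μ) :
    Integrable (fun x => V (x - h)) μ ∧ ∫ x, V (x - h) ∂μ ≤ l * ∫ x, V x ∂μ := by
  have hs := shift_le μ h l htail V hm hc hV0 hpos
  have hc' : Continuous (fun x => V (x - h)) := by fun_prop
  rw [← ofReal_integral_eq_lintegral_ofReal hi (Filter.Eventually.of_forall hpos),
    ← ENNReal.ofReal_mul hl0] at hs
  have hi' : Integrable (fun x => V (x - h)) μ := by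
    refine ⟨hc'.aestronglyMeasurable, ?_⟩
    rw [hasFiniteIntegral_iff_ofReal (Filter.Eventually.of_forall fun x => hpos (x - h))]
    exact hs.trans_lt ENNReal.ofReal_lt_top
  refine ⟨hi', ?_⟩
  rw [← ofReal_integral_eq_lintegral_ofReal hi' (Filter.Eventually.of_forall fun x => hpos (x - h))] at hs
  exact (ENNReal.ofReal_le_ofReal_iff
    (mul_nonneg hl0 (integral_nonneg hpos))).mp hs

lemma core_s14 (μ : Measure ℝ) [IsProbabilityMeasure μ] (h l : ℝ) (hh : 0 < h) (hl0 : 0 ≤ l) (hl1 : l < 1)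
    (htail : ∀ x : ℝ, 0 ≤ x → μ (Set.Ici (x + h)) ≤ ENNReal.ofReal l * μ (Set.Ici x))
    (u : ℝ → ℝ) (hm : Monotone u) (hc : Continuous u) (hu0 : ∀ x, x ≤ 0 → u x = 0)
    (hL : ∀ x, u x - u (x - h) ≤ (1 - l) ^ 2 / 68) :
    Integrable (fun x => 2 * cosh (u x) - 2) μ ∧
    Integrable (fun x => exp (u x) * (u x - u (x - h)) ^ 2) μ ∧
    ∫ x, (2 * cosh (u x) - 2) ∂μ ≤
      4 / (1 - l) ^ 2 * ∫ x, exp (u x) * (u x - u (x - h)) ^ 2 ∂μ := by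
  obtain ⟨e, he⟩ : ∃ e, e = 1 - l := ⟨_, rfl⟩
  have hle : l = 1 - e := by linarith
  rw [← he] at hL ⊢
  have he0 : 0 < e := by linarith
  have he1 : e ≤ 1 := by linarith
  have hupos : ∀ x, 0 ≤ u x := fun x => by
    rcases le_total x 0 with hx | hx
    · rw [hu0 x hx]
    · rw [← hu0 0 le_rfl]; exact hm hx
  have hd0 : ∀ x, 0 ≤ u x - u (x - h) := fun x => sub_nonneg.mpr (hm (by linarith))
  obtain ⟨W, hW⟩ : ∃ W : ℝ → ℝ, W = fun x => 2 * cosh (u x) - 2 := ⟨_, rfl⟩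
  obtain ⟨G, hG⟩ : ∃ G : ℝ → ℝ, G = fun x => exp (u x) * (u x - u (x - h)) ^ 2 := ⟨_, rfl⟩
  have hWx : ∀ x, W x = 2 * cosh (u x) - 2 := fun x => by rw [hW]
  have hGx : ∀ x, G x = exp (u x) * (u x - u (x - h)) ^ 2 := fun x => by rw [hG]
  rw [← hW, ← hG]
  have hWc : Continuous W := by rw [hW]; exact (continuous_const.mul (continuous_cosh.comp hc)).sub continuous_const
  have hGc : Continuous G := by rw [hG]; fun_prop
  have hWpos : ∀ x, 0 ≤ W x := fun x => by rw [hWx]; linarith [one_le_cosh (u x)]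
  have hGpos : ∀ x, 0 ≤ G x := fun x => by rw [hGx]; positivity
  have hWm : Monotone W := fun x y hxy => by
    rw [hWx, hWx]
    have : cosh (u x) ≤ cosh (u y) := by
      rw [cosh_le_cosh, abs_of_nonneg (hupos x), abs_of_nonneg (hupos y)]; exact hm hxy
    linarith
  have hW0 : ∀ x, x ≤ 0 → W x = 0 := fun x hx => by rw [hWx, hu0 x hx]; simp
  have hstep : ∀ x, (1 - e / 2) * W x ≤ W (x - h) + 2 / e * G x := fun x => by
    rw [hWx, hWx, hGx]
    exact W_step _ _ e (hupos _) (hm (by linarith)) he0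
  have hexpW : ∀ x, exp (u x) ≤ W x + 2 := fun x => by
    rw [hWx, cosh_eq]; linarith [exp_pos (-(u x))]
  have hGW : ∀ x, G x ≤ e ^ 4 / 4624 * (W x + 2) := fun x => by
    rw [hGx, mul_comm]
    have : (u x - u (x - h)) ^ 2 ≤ (e ^ 2 / 68) ^ 2 := pow_le_pow_left₀ (hd0 x) (hL x) 2
    have h2 : (e ^ 2 / 68) ^ 2 = e ^ 4 / 4624 := by ring
    rw [h2] at this
    exact mul_le_mul this (hexpW x) (exp_pos _).le (by positivity)
  have hstep2 : ∀ x, (1 - 3 * e / 4) * W x ≤ W (x - h) + e / 2 := fun x => by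
    have h1 : 2 / e * G x ≤ e / 4 * (W x + 2) := by
      have h2 : 2 / e * G x ≤ 2 / e * (e ^ 4 / 4624 * (W x + 2)) :=
        mul_le_mul_of_nonneg_left (hGW x) (by positivity)
      have h3 : 2 / e * (e ^ 4 / 4624 * (W x + 2)) = e ^ 3 / 2312 * (W x + 2) := by
        field_simp; ring
      have h4 : e ^ 3 / 2312 ≤ e / 4 := by nlinarith [mul_pos he0 he0]
      have := mul_le_mul_of_nonneg_right h4 (by linarith [hWpos x] : 0 ≤ W x + 2)
      linarith
    have := hstep x
    linarith
  have hbound : ∀ N : ℕ, ∫⁻ x, ENNReal.ofReal (min (W x) N) ∂μ ≤ ENNReal.ofReal 2 := fun N => by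
    have hNn : (0 : ℝ) ≤ N := Nat.cast_nonneg N
    have hVc : Continuous (fun x => min (W x) (N : ℝ)) := hWc.min continuous_const
    have hVpos : ∀ x, 0 ≤ min (W x) (N : ℝ) := fun x => le_min (hWpos x) hNn
    have hVi : Integrable (fun x => min (W x) (N : ℝ)) μ :=
      Integrable.of_bound hVc.aestronglyMeasurable (N : ℝ) (Filter.Eventually.of_forall fun x => by
        rw [Real.norm_eq_abs, abs_of_nonneg (hVpos x)]; exact min_le_right _ _)
    obtain ⟨i1, i2⟩ := shift_real μ h l hl0 htail (fun x => min (W x) (N : ℝ))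
      (fun x y hxy => min_le_min_right _ (hWm hxy)) hVc
      (fun x hx => by simp only [hW0 x hx]; exact min_eq_left hNn) hVpos hVi
    rw [← ofReal_integral_eq_lintegral_ofReal hVi (Filter.Eventually.of_forall hVpos)]
    apply ENNReal.ofReal_le_ofReal
    have hp : ∫ x, (1 - 3 * e / 4) * min (W x) (N : ℝ) ∂μ ≤ ∫ x, (min (W (x - h)) (N : ℝ) + e / 2) ∂μ := by
      refine integral_mono (hVi.const_mul _) (i1.add (integrable_const _)) fun x => ?_
      have hk : 0 ≤ 1 - 3 * e / 4 := by linarith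
      have a1 : (1 - 3 * e / 4) * min (W x) (N : ℝ) ≤ W (x - h) + e / 2 :=
        (mul_le_mul_of_nonneg_left (min_le_left _ _) hk).trans (hstep2 x)
      have a2 : (1 - 3 * e / 4) * min (W x) (N : ℝ) ≤ N + e / 2 := by
        have := min_le_right (W x) (N : ℝ)
        nlinarith [hVpos x]
      show (1 - 3 * e / 4) * min (W x) (N : ℝ) ≤ min (W (x - h)) (N : ℝ) + e / 2
      rw [← min_add_add_right]
      exact le_min a1 a2
    rw [integral_const_mul, integral_add i1 (integrable_const _)] at hp
    simp only [integral_const, probReal_univ, one_smul] at hp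
    rw [hle] at i2
    have : e / 4 * ∫ x, min (W x) (N : ℝ) ∂μ ≤ e / 4 * 2 := by linarith
    exact le_of_mul_le_mul_left this (by linarith)
  have hWi : Integrable W μ := by
    refine ⟨hWc.aestronglyMeasurable, ?_⟩
    rw [hasFiniteIntegral_iff_ofReal (Filter.Eventually.of_forall hWpos)]
    refine lt_of_le_of_lt ?_ (ENNReal.ofReal_lt_top (r := 2))
    refine le_of_tendsto' (lintegral_tendsto_of_tendsto_of_monotone
      (f := fun (N : ℕ) x => ENNReal.ofReal (min (W x) N)) (F := fun x => ENNReal.ofReal (W x))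
      (fun N => ((hWc.min continuous_const).measurable.ennreal_ofReal).aemeasurable) ?_ ?_) hbound
    · refine Filter.Eventually.of_forall fun x N M hNM => ENNReal.ofReal_le_ofReal ?_
      exact min_le_min_left _ (Nat.cast_le.mpr hNM)
    · refine Filter.Eventually.of_forall fun x => ?_
      refine tendsto_const_nhds.congr' ?_
      obtain ⟨M, hM⟩ := exists_nat_ge (W x)
      filter_upwards [Filter.eventually_ge_atTop M] with N hN
      rw [min_eq_left (hM.trans (Nat.cast_le.mpr hN))]
  have hGi : Integrable G μ := by
    refine Integrable.mono' ((hWi.add (integrable_const 2)).const_mul (e ^ 4 / 4624)) hGc.aestronglyMeasurable ?_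
    refine Filter.Eventually.of_forall fun x => ?_
    rw [Real.norm_eq_abs, abs_of_nonneg (hGpos x)]; exact hGW x
  refine ⟨hWi, hGi, ?_⟩
  obtain ⟨i1, i2⟩ := shift_real μ h l hl0 htail W hWm hWc hW0 hWpos hWi
  have hp : ∫ x, (1 - e / 2) * W x ∂μ ≤ ∫ x, (W (x - h) + 2 / e * G x) ∂μ :=
    integral_mono (hWi.const_mul _) (i1.add (hGi.const_mul _)) hstep
  rw [integral_const_mul, integral_add i1 (hGi.const_mul _), integral_const_mul] at hp
  rw [hle] at i2
  have : e / 2 * ∫ x, W x ∂μ ≤ 2 / e * ∫ x, G x ∂μ := by linarith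
  have h3 : 4 / e ^ 2 * ∫ x, G x ∂μ = 2 / e * (2 / e * ∫ x, G x ∂μ) := by field_simp; ring
  have h4 : ∫ x, W x ∂μ = 2 / e * (e / 2 * ∫ x, W x ∂μ) := by field_simp
  rw [h3, h4]
  exact mul_le_mul_of_nonneg_left this (by positivity)

noncomputable def UU (f : ℝ → ℝ) (x : ℝ) : ℝ := max (f (max x 0)) 0

lemma UU_nonpos (f : ℝ → ℝ) (f0 : f 0 = 0) (x : ℝ) (hx : x ≤ 0) : UU f x = 0 := by
  simp [UU, max_eq_right hx, f0]

lemma UU_mono (f : ℝ → ℝ) (f0 : f 0 = 0) (hf : ConvexOn ℝ Set.univ f) : Monotone (UU f) := by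
  have key : ∀ x y : ℝ, 0 ≤ x → x ≤ y → max (f x) 0 ≤ max (f y) 0 := by
    intro x y hx hxy
    refine max_le ?_ (le_max_right _ _)
    rcases hx.eq_or_lt with rfl | hx
    · rw [f0]; exact le_max_right _ _
    have hy : 0 < y := hx.trans_le hxy
    have hr : x / y ≤ 1 := (div_le_one hy).mpr hxy
    have hr0 : 0 ≤ x / y := by positivity
    have := hf.2 (mem_univ 0) (mem_univ y) (sub_nonneg.mpr hr) hr0 (by ring)
    simp only [smul_eq_mul, mul_zero, f0, zero_add] at this
    rw [div_mul_cancel₀ _ hy.ne'] at this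
    calc f x ≤ x / y * f y := this
      _ ≤ x / y * max (f y) 0 := mul_le_mul_of_nonneg_left (le_max_left _ _) hr0
      _ ≤ 1 * max (f y) 0 := mul_le_mul_of_nonneg_right hr (le_max_right _ _)
      _ = _ := one_mul _
  intro x y hxy
  exact key _ _ (le_max_right _ _) (max_le_max_right _ hxy)

lemma UU_diff (f : ℝ → ℝ) (L h : ℝ) (hL : 0 ≤ L) (hh : 0 < h)
    (hlip : ∀ x y, |f x - f y| ≤ L * |x - y|) (x : ℝ) : UU f x - UU f (x - h) ≤ L * h := by
  unfold UU
  have h1 := abs_max_sub_max_le_abs (f (max x 0)) (f (max (x - h) 0)) 0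
  have h2 := abs_max_sub_max_le_abs x (x - h) 0
  have h3 := hlip (max x 0) (max (x - h) 0)
  have h4 : |x - (x - h)| = h := by rw [sub_sub_cancel, abs_of_pos hh]
  rw [h4] at h2
  have h5 := mul_le_mul_of_nonneg_left h2 hL
  exact (le_abs_self _).trans (h1.trans (h3.trans h5))

lemma lip_cont (f : ℝ → ℝ) (L : ℝ) (hL : 0 ≤ L)
    (hlip : ∀ x y, |f x - f y| ≤ L * |x - y|) : Continuous f :=
  (LipschitzWith.of_dist_le_mul (K := ⟨L, hL⟩) fun x y => by
    rw [Real.dist_eq, Real.dist_eq]; exact hlip x y).continuous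

lemma exp_neg_le (z : ℝ) (h0 : 0 ≤ z) (h1 : z ≤ 1) : exp (-z) ≤ 1 - z / 2 := by
  rw [exp_neg]
  have h2 := Real.add_one_le_exp z
  rw [inv_le_comm₀ (exp_pos _) (by linarith)]
  refine le_trans ?_ h2
  rw [inv_le_iff_one_le_mul₀ (by linarith)]
  nlinarith

lemma pt (f : ℝ → ℝ) (f0 : f 0 = 0) (hf : ConvexOn ℝ Set.univ f) (L h e D : ℝ) (hL : 0 ≤ L) (hh : 0 < h)
    (he0 : 0 < e) (he1 : e ≤ 1) (hLh : L * h = e ^ 2 / 68) (hD : D = 17 * h / e ^ 2)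
    (hlip : ∀ x y, |f x - f y| ≤ L * |x - y|) (x : ℝ) (hx : 0 ≤ x) :
    ∃ y, exp (f y + (x - y) ^ 2 / (2 * D ^ 2)) + exp (- f x) ≤
      2 + (2 * cosh (UU f x) - 2) + (2 * cosh (UU (fun z => f (-z)) x) - 2)
        - 8 / e ^ 2 * (exp (UU f x) * (UU f x - UU f (x - h)) ^ 2) := by
  have hmono := UU_mono f f0 hf
  have hUx : UU f x = max (f x) 0 := by rw [UU, max_eq_left hx]
  have hUpos : ∀ z, 0 ≤ UU f z := fun z => le_max_right _ _
  have hd0 : 0 ≤ UU f x - UU f (x - h) := sub_nonneg.mpr (hmono (by linarith))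
  rcases le_or_gt (f x) 0 with hfx | hfx
  · refine ⟨x, ?_⟩
    have h1 : UU f x = 0 := by rw [hUx, max_eq_right hfx]
    have h2 : UU f (x - h) = 0 := by linarith [hUpos (x - h)]
    rw [h1, h2]
    have h3 : UU (fun z => f (-z)) x = max (f (-x)) 0 := by rw [UU, max_eq_left hx]
    have h4 := hf.2 (mem_univ x) (mem_univ (-x)) (by norm_num : (0:ℝ) ≤ 1 / 2) (by norm_num : (0:ℝ) ≤ 1 / 2)
      (by norm_num)
    simp only [smul_eq_mul] at h4
    have h5 : (1:ℝ) / 2 * x + 1 / 2 * -x = 0 := by ring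
    rw [h5, f0] at h4
    have h6 : 0 ≤ f (-x) := by linarith
    rw [h3, max_eq_left h6]
    have h7 : cosh (f x) ≤ cosh (f (-x)) := by
      rw [cosh_le_cosh, abs_of_nonneg h6, abs_of_nonpos hfx]; linarith
    rw [cosh_eq (f x)] at h7
    simp
    linarith
  · have h1 : UU f x = f x := by rw [hUx, max_eq_left hfx.le]
    obtain ⟨d, hd⟩ : ∃ d, d = UU f x - UU f (x - h) := ⟨_, rfl⟩
    have hdL : d ≤ e ^ 2 / 68 := by rw [hd, ← hLh]; exact UU_diff f L h hL hh hlip x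
    rw [← hd] at hd0 ⊢
    obtain ⟨s, hs⟩ : ∃ s, s = 20 / e ^ 2 * d := ⟨_, rfl⟩
    obtain ⟨z, hz⟩ : ∃ z, z = max (x - h) 0 := ⟨_, rfl⟩
    have hs0 : 0 ≤ s := by rw [hs]; positivity
    have hs1 : s ≤ 1 := by
      rw [hs]
      calc 20 / e ^ 2 * d ≤ 20 / e ^ 2 * (e ^ 2 / 68) := mul_le_mul_of_nonneg_left hdL (by positivity)
        _ = 20 / 68 := by field_simp
        _ ≤ 1 := by norm_num
    have hfz : f z ≤ f x - d := by
      have : f z ≤ UU f (x - h) := by rw [hz]; exact le_max_left _ _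
      linarith
    have hzx : z ≤ x := by rw [hz]; exact max_le (by linarith) hx
    have hzx' : x - z ≤ h := by rw [hz]; linarith [le_max_left (x - h) 0]
    have hcx := hf.2 (mem_univ x) (mem_univ z) (sub_nonneg.mpr hs1) hs0 (by ring)
    simp only [smul_eq_mul] at hcx
    refine ⟨(1 - s) * x + s * z, ?_⟩
    have hcost : (x - ((1 - s) * x + s * z)) ^ 2 / (2 * D ^ 2) ≤ d ^ 2 / e ^ 2 := by
      have e1 : (x - ((1 - s) * x + s * z)) ^ 2 = s ^ 2 * (x - z) ^ 2 := by ring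
      have e2 : (x - z) ^ 2 ≤ h ^ 2 := pow_le_pow_left₀ (by linarith) hzx' 2
      have e3 : d ^ 2 / e ^ 2 = d ^ 2 / e ^ 2 := rfl
      rw [e1]
      calc s ^ 2 * (x - z) ^ 2 / (2 * D ^ 2) ≤ s ^ 2 * h ^ 2 / (2 * D ^ 2) := by gcongr
        _ = 400 / 578 * d ^ 2 := by rw [hs, hD]; field_simp; ring
        _ ≤ d ^ 2 := by nlinarith [sq_nonneg d]
        _ ≤ d ^ 2 / e ^ 2 := by
            rw [le_div_iff₀ (by positivity)]
            have : e ^ 2 ≤ 1 := pow_le_one₀ he0.le he1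
            nlinarith [sq_nonneg d]
    have hsd : s * d = 20 * (d ^ 2 / e ^ 2) := by rw [hs]; ring
    have hq0 : 0 ≤ d ^ 2 / e ^ 2 := by positivity
    have hfy : f ((1 - s) * x + s * z) ≤ f x - s * d := by
      have := mul_le_mul_of_nonneg_left hfz hs0
      linarith
    have htot : f ((1 - s) * x + s * z) + (x - ((1 - s) * x + s * z)) ^ 2 / (2 * D ^ 2)
        ≤ f x + -(16 * (d ^ 2 / e ^ 2)) := by linarith
    have hq1 : 16 * (d ^ 2 / e ^ 2) ≤ 1 := by
      have : d ^ 2 ≤ (e ^ 2 / 68) ^ 2 := pow_le_pow_left₀ hd0 hdL 2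
      have h2 : d ^ 2 / e ^ 2 ≤ e ^ 2 / 4624 := by
        rw [div_le_iff₀ (by positivity)]; calc _ ≤ _ := this
          _ = _ := by ring
      have : e ^ 2 ≤ 1 := pow_le_one₀ he0.le he1
      linarith
    have h10 := exp_le_exp.mpr htot
    rw [exp_add (f x)] at h10
    have h11 := mul_le_mul_of_nonneg_left (exp_neg_le _ (by positivity) hq1) (exp_pos (f x)).le
    have h12 := one_le_cosh (UU (fun z => f (-z)) x)
    have h13 : 8 / e ^ 2 * (exp (UU f x) * d ^ 2) = exp (f x) * (8 * (d ^ 2 / e ^ 2)) := by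
      rw [h1]; ring
    rw [h13, h1, cosh_eq (f x)]
    linarith

lemma oneDim0 (μ : Measure ℝ) [IsProbabilityMeasure μ] (h l : ℝ) (hh : 0 < h) (hl0 : 0 ≤ l) (hl1 : l < 1)
    (hsym : μ.map (fun x => -x) = μ)
    (htail : ∀ x : ℝ, 0 ≤ x → μ (Set.Ici (x + h)) ≤ ENNReal.ofReal l * μ (Set.Ici x))
    (f : ℝ → ℝ) (f0 : f 0 = 0) (hf : ConvexOn ℝ Set.univ f) (L D : ℝ) (hL : 0 ≤ L)
    (hLh : L * h = (1 - l) ^ 2 / 68) (hD : D = 17 * h / (1 - l) ^ 2)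
    (hlip : ∀ x y, |f x - f y| ≤ L * |x - y|) (φ : ℝ → ENNReal)
    (hφ : ∀ x y, φ x ≤ ENNReal.ofReal (exp (f y + (x - y) ^ 2 / (2 * D ^ 2)))) :
    ∫⁻ x, φ x ∂μ + ∫⁻ x, ENNReal.ofReal (exp (- f x)) ∂μ ≤ 2 := by
  have he0 : 0 < 1 - l := by linarith
  have he1 : 1 - l ≤ 1 := by linarith
  set g : ℝ → ℝ := fun z => f (-z) with hg
  have g0 : g 0 = 0 := by simp [hg, f0]
  have hgf : (fun z => g (-z)) = f := by ext z; simp [hg]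
  have hgc : ConvexOn ℝ Set.univ g := by
    refine ⟨convex_univ, fun x _ y _ a b ha hb hab => ?_⟩
    have := hf.2 (mem_univ (-x)) (mem_univ (-y)) ha hb hab
    simp only [smul_eq_mul, hg] at this ⊢
    convert this using 2
    ring
  have hglip : ∀ x y, |g x - g y| ≤ L * |x - y| := fun x y => by
    have := hlip (-x) (-y)
    rwa [show -x - -y = -(x - y) by ring, abs_neg] at this
  have hfc := lip_cont f L hL hlip
  have hgcont := lip_cont g L hL hglip
  have Uc : ∀ f : ℝ → ℝ, Continuous f → Continuous (UU f) := fun f hf => by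
    unfold UU; fun_prop
  obtain ⟨a1, a2, a3⟩ := core_s14 μ h l hh hl0 hl1 htail (UU f) (UU_mono f f0 hf) (Uc f hfc) (UU_nonpos f f0)
    (fun x => by rw [← hLh]; exact UU_diff f L h hL hh hlip x)
  obtain ⟨b1, b2, b3⟩ := core_s14 μ h l hh hl0 hl1 htail (UU g) (UU_mono g g0 hgc) (Uc g hgcont) (UU_nonpos g g0)
    (fun x => by rw [← hLh]; exact UU_diff g L h hL hh hglip x)
  have hf1 := pt f f0 hf L h (1 - l) D hL hh he0 he1 hLh hD hlip
  have hg1 := pt g g0 hgc L h (1 - l) D hL hh he0 he1 hLh hD hglip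
  rw [hgf] at hg1
  rw [← hg] at hf1
  obtain ⟨k, hk⟩ : ∃ k, k = 8 / (1 - l) ^ 2 := ⟨_, rfl⟩
  rw [← hk] at hf1 hg1
  have hk4 : 4 / (1 - l) ^ 2 = k / 2 := by rw [hk]; ring
  rw [hk4] at a3 b3
  obtain ⟨Wp, hWp⟩ : ∃ W : ℝ → ℝ, W = fun x => 2 * cosh (UU f x) - 2 := ⟨_, rfl⟩
  obtain ⟨Wm, hWm⟩ : ∃ W : ℝ → ℝ, W = fun x => 2 * cosh (UU g x) - 2 := ⟨_, rfl⟩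
  obtain ⟨Gp, hGp⟩ : ∃ W : ℝ → ℝ, W = fun x => exp (UU f x) * (UU f x - UU f (x - h)) ^ 2 := ⟨_, rfl⟩
  obtain ⟨Gm, hGm⟩ : ∃ W : ℝ → ℝ, W = fun x => exp (UU g x) * (UU g x - UU g (x - h)) ^ 2 := ⟨_, rfl⟩
  rw [← hWp, ← hGp] at a3
  rw [← hWm, ← hGm] at b3
  rw [← hWp] at a1
  rw [← hWm] at b1
  rw [← hGp] at a2
  rw [← hGm] at b2
  have hWp0 : ∀ x ≤ 0, Wp x = 0 := fun x hx => by rw [hWp]; simp [UU_nonpos f f0 x hx]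
  have hWm0 : ∀ x ≤ 0, Wm x = 0 := fun x hx => by rw [hWm]; simp [UU_nonpos g g0 x hx]
  have hGp0 : ∀ x ≤ 0, Gp x = 0 := fun x hx => by
    rw [hGp]; simp [UU_nonpos f f0 x hx, UU_nonpos f f0 (x - h) (by linarith)]
  have hGm0 : ∀ x ≤ 0, Gm x = 0 := fun x hx => by
    rw [hGm]; simp [UU_nonpos g g0 x hx, UU_nonpos g g0 (x - h) (by linarith)]
  have hf2 : ∀ x, 0 ≤ x → ∃ y, exp (f y + (x - y) ^ 2 / (2 * D ^ 2)) + exp (- f x) ≤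
      2 + Wp x + Wm x - k * Gp x := by
    rw [hWp, hWm, hGp]; exact hf1
  have hg2 : ∀ x, 0 ≤ x → ∃ y, exp (g y + (x - y) ^ 2 / (2 * D ^ 2)) + exp (- g x) ≤
      2 + Wm x + Wp x - k * Gm x := by
    rw [hWp, hWm, hGm]; exact hg1
  have hmp : MeasurePreserving (fun x : ℝ => -x) μ μ := ⟨measurable_neg, hsym⟩
  have hme : MeasurableEmbedding (fun x : ℝ => -x) := (MeasurableEquiv.neg ℝ).measurableEmbedding
  have hci : ∀ W : ℝ → ℝ, Integrable W μ → Integrable (fun x => W (-x)) μ := fun W hW =>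
    hmp.integrable_comp_of_integrable hW
  have hce : ∀ W : ℝ → ℝ, ∫ x, W (-x) ∂μ = ∫ x, W x ∂μ := fun W => hmp.integral_comp hme W
  have hpt : ∀ x, φ x + ENNReal.ofReal (exp (- f x)) ≤
      ENNReal.ofReal (2 + (Wp x + Wm x + Wp (-x) + Wm (-x)) - k * (Gp x + Gm (-x))) := by
    intro x
    have : ∃ y, exp (f y + (x - y) ^ 2 / (2 * D ^ 2)) + exp (- f x) ≤
        2 + (Wp x + Wm x + Wp (-x) + Wm (-x)) - k * (Gp x + Gm (-x)) := by
      rcases le_total 0 x with hx | hx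
      · obtain ⟨y, hy⟩ := hf2 x hx
        refine ⟨y, ?_⟩
        rw [hWp0 (-x) (by linarith), hWm0 (-x) (by linarith), hGm0 (-x) (by linarith)]
        linarith
      · obtain ⟨y, hy⟩ := hg2 (-x) (by linarith)
        refine ⟨-y, ?_⟩
        rw [hWp0 x hx, hWm0 x hx, hGp0 x hx]
        simp only [hg, neg_neg] at hy
        rw [show (x - -y) ^ 2 = (-x - y) ^ 2 by ring]
        linarith
    obtain ⟨y, hy⟩ := this
    calc φ x + ENNReal.ofReal (exp (- f x)) ≤ ENNReal.ofReal (exp (f y + (x - y) ^ 2 / (2 * D ^ 2)))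
          + ENNReal.ofReal (exp (- f x)) := by gcongr; exact hφ x y
      _ = ENNReal.ofReal (exp (f y + (x - y) ^ 2 / (2 * D ^ 2)) + exp (- f x)) :=
          (ENNReal.ofReal_add (exp_pos _).le (exp_pos _).le).symm
      _ ≤ _ := ENNReal.ofReal_le_ofReal hy
  have hpos : ∀ x, 0 ≤ 2 + (Wp x + Wm x + Wp (-x) + Wm (-x)) - k * (Gp x + Gm (-x)) := by
    intro x
    by_contra hlt
    have h1 := hpt x
    rw [ENNReal.ofReal_of_nonpos (not_le.mp hlt).le] at h1
    have h2 : ENNReal.ofReal (exp (- f x)) ≤ 0 := le_trans le_add_self h1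
    rw [nonpos_iff_eq_zero, ENNReal.ofReal_eq_zero] at h2
    exact absurd h2 (not_le.mpr (exp_pos _))
  have hmeas : Measurable (fun x => ENNReal.ofReal (exp (- f x))) := by
    have : Continuous (fun x => exp (- f x)) := by fun_prop
    exact this.measurable.ennreal_ofReal
  rw [← lintegral_add_right _ hmeas]
  refine (lintegral_mono hpt).trans ?_
  have i1 := hci Wp a1
  have i2 := hci Wm b1
  have i3 := hci Gm b2
  have iA : Integrable (fun x => Wp x + Wm x + Wp (-x) + Wm (-x)) μ := ((a1.add b1).add i1).add i2
  have iB : Integrable (fun x => k * (Gp x + Gm (-x))) μ := (a2.add i3).const_mul k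
  have iC : Integrable (fun x => 2 + (Wp x + Wm x + Wp (-x) + Wm (-x))) μ := (integrable_const 2).add iA
  have iD : Integrable (fun x => 2 + (Wp x + Wm x + Wp (-x) + Wm (-x)) - k * (Gp x + Gm (-x))) μ := iC.sub iB
  rw [← ofReal_integral_eq_lintegral_ofReal iD (Filter.Eventually.of_forall hpos)]
  rw [← ENNReal.ofReal_ofNat]
  apply ENNReal.ofReal_le_ofReal
  have s1 : ∫ x, ((2 + (Wp x + Wm x + Wp (-x) + Wm (-x))) - k * (Gp x + Gm (-x))) ∂μ =
      2 + (∫ x, Wp x ∂μ + ∫ x, Wm x ∂μ + ∫ x, Wp x ∂μ + ∫ x, Wm x ∂μ)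
        - k * (∫ x, Gp x ∂μ + ∫ x, Gm x ∂μ) := by
    rw [integral_sub iC iB, integral_add (integrable_const 2) iA,
      integral_add (f := fun x => Wp x + Wm x + Wp (-x)) ((a1.add b1).add i1) i2,
      integral_add (f := fun x => Wp x + Wm x) (a1.add b1) i1,
      integral_add a1 b1, integral_const_mul, integral_add a2 i3, hce, hce, hce]
    simp
  have s2 := s1.le
  refine s2.trans ?_
  have a3' : ∫ x, Wp x ∂μ ≤ k / 2 * ∫ x, Gp x ∂μ := a3
  have b3' : ∫ x, Wm x ∂μ ≤ k / 2 * ∫ x, Gm x ∂μ := b3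
  linarith

lemma amgm (a b : ENNReal) (hab : a + b ≤ 2) : a * b ≤ 1 := by
  have ha : a ≠ ⊤ := ne_top_of_le_ne_top ENNReal.ofNat_ne_top (le_self_add.trans hab)
  have hb : b ≠ ⊤ := ne_top_of_le_ne_top ENNReal.ofNat_ne_top (le_add_self.trans hab)
  lift a to NNReal using ha
  lift b to NNReal using hb
  norm_cast at hab ⊢
  have h1 : (a : ℝ) + b ≤ 2 := by exact_mod_cast hab
  have : (a : ℝ) * b ≤ 1 := by nlinarith [sq_nonneg ((a : ℝ) - b), a.2, b.2]
  exact_mod_cast this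

lemma oneDim (μ : Measure ℝ) [IsProbabilityMeasure μ] (h l : ℝ) (hh : 0 < h) (hl0 : 0 ≤ l) (hl1 : l < 1)
    (hsym : μ.map (fun x => -x) = μ)
    (htail : ∀ x : ℝ, 0 ≤ x → μ (Set.Ici (x + h)) ≤ ENNReal.ofReal l * μ (Set.Ici x))
    (f : ℝ → ℝ) (hf : ConvexOn ℝ Set.univ f) (L D : ℝ) (hL : 0 ≤ L)
    (hLh : L * h = (1 - l) ^ 2 / 68) (hD : D = 17 * h / (1 - l) ^ 2)
    (hlip : ∀ x y, |f x - f y| ≤ L * |x - y|) (φ : ℝ → ENNReal)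
    (hφ : ∀ x y, φ x ≤ ENNReal.ofReal (exp (f y + (x - y) ^ 2 / (2 * D ^ 2)))) :
    (∫⁻ x, φ x ∂μ) * ∫⁻ x, ENNReal.ofReal (exp (- f x)) ∂μ ≤ 1 := by
  have h1 := oneDim0 μ h l hh hl0 hl1 hsym htail (fun x => f x - f 0) (by simp)
    (hf.sub (concaveOn_const _ convex_univ)) L D hL hLh hD
    (fun x y => by simpa using hlip x y) (fun x => φ x * ENNReal.ofReal (exp (- f 0)))
    (fun x y => by
      calc φ x * ENNReal.ofReal (exp (- f 0)) ≤ ENNReal.ofReal (exp (f y + (x - y) ^ 2 / (2 * D ^ 2)))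
            * ENNReal.ofReal (exp (- f 0)) := by gcongr; exact hφ x y
        _ = _ := by
          rw [← ENNReal.ofReal_mul (exp_pos _).le, ← exp_add]; ring_nf)
  have h2 := amgm _ _ h1
  have e1 : ∀ x, ENNReal.ofReal (exp (-(f x - f 0))) =
      ENNReal.ofReal (exp (f 0)) * ENNReal.ofReal (exp (- f x)) := fun x => by
    rw [← ENNReal.ofReal_mul (exp_pos _).le, ← exp_add]; ring_nf
  simp only [e1] at h2
  rw [lintegral_mul_const' _ _ ENNReal.ofReal_ne_top, lintegral_const_mul' _ _ ENNReal.ofReal_ne_top] at h2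
  have e2 : ENNReal.ofReal (exp (- f 0)) * ENNReal.ofReal (exp (f 0)) = 1 := by
    rw [← ENNReal.ofReal_mul (exp_pos _).le, ← exp_add]; simp
  calc _ = (∫⁻ x, φ x ∂μ) * (ENNReal.ofReal (exp (- f 0)) * ENNReal.ofReal (exp (f 0))) *
        ∫⁻ x, ENNReal.ofReal (exp (- f x)) ∂μ := by rw [e2, mul_one]
    _ ≤ 1 := by convert h2 using 1; ring

lemma lip_cont_pi (n : ℕ) (f : (Fin n → ℝ) → ℝ) (L : ℝ) (hL : 0 ≤ L)
    (hlip : ∀ x y, |f x - f y| ≤ L * ∑ i, |x i - y i|) : Continuous f := by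
  refine (LipschitzWith.of_dist_le_mul (K := ⟨L * n, by positivity⟩) fun x y => ?_).continuous
  rw [Real.dist_eq]
  refine (hlip x y).trans ?_
  have : ∑ i, |x i - y i| ≤ ∑ _i : Fin n, dist x y :=
    Finset.sum_le_sum fun i _ => by rw [← Real.dist_eq]; exact dist_le_pi_dist x y i
  rw [Finset.sum_const, Finset.card_univ, Fintype.card_fin, nsmul_eq_mul] at this
  calc L * ∑ i, |x i - y i| ≤ L * (n * dist x y) := mul_le_mul_of_nonneg_left this hL
    _ = _ := by rw [← mul_assoc]; rfl

noncomputable def EE (n : ℕ) (v : ℝ) : Fin (n + 1) → ℝ := Fin.cons v 0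

noncomputable def qq (n : ℕ) (D : ℝ) (f : (Fin (n + 1) → ℝ) → ℝ) (p : Fin (n + 1) → ℝ) : ℝ :=
  ⨅ v : ℝ, (f (p + EE n v) + v ^ 2 / (2 * D ^ 2))

section
variable (n : ℕ) (L D : ℝ) (f : (Fin (n + 1) → ℝ) → ℝ)

lemma qq_bdd (hD : 0 < D)
    (hlip : ∀ x y, |f x - f y| ≤ L * ∑ i, |x i - y i|) (p : Fin (n + 1) → ℝ) :
    BddBelow (range fun v : ℝ => (f (p + EE n v) + v ^ 2 / (2 * D ^ 2))) := by
  refine ⟨f p - L ^ 2 * D ^ 2 / 2, ?_⟩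
  rintro _ ⟨v, rfl⟩
  have h1 := hlip (p + EE n v) p
  have h2 : ∑ i, |(p + EE n v) i - p i| = |v| := by
    rw [Fin.sum_univ_succ]; simp [EE]
  rw [h2] at h1
  have h3 := neg_abs_le (f (p + EE n v) - f p)
  have h4 : L * |v| ≤ v ^ 2 / (2 * D ^ 2) + L ^ 2 * D ^ 2 / 2 := by
    have h5 := sq_nonneg (|v| / D - L * D)
    have h6 : (|v| / D - L * D) ^ 2 = 2 * (v ^ 2 / (2 * D ^ 2)) - 2 * (L * |v|) + L ^ 2 * D ^ 2 := by
      rw [← sq_abs v]; field_simp; ring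
    linarith
  show f p - L ^ 2 * D ^ 2 / 2 ≤ f (p + EE n v) + v ^ 2 / (2 * D ^ 2)
  linarith

lemma qq_le (hD : 0 < D)
    (hlip : ∀ x y, |f x - f y| ≤ L * ∑ i, |x i - y i|) (p : Fin (n + 1) → ℝ) (v : ℝ) :
    qq n D f p ≤ f (p + EE n v) + v ^ 2 / (2 * D ^ 2) :=
  ciInf_le (qq_bdd n L D f hD hlip p) v

lemma qq_approx (p : Fin (n + 1) → ℝ) (δ : ℝ) (hδ : 0 < δ) :
    ∃ v, f (p + EE n v) + v ^ 2 / (2 * D ^ 2) < qq n D f p + δ :=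
  exists_lt_of_ciInf_lt (by unfold qq; linarith)

lemma qq_lip (hD : 0 < D)
    (hlip : ∀ x y, |f x - f y| ≤ L * ∑ i, |x i - y i|) (p r : Fin (n + 1) → ℝ) :
    |qq n D f p - qq n D f r| ≤ L * ∑ i, |p i - r i| := by
  have key : ∀ p r : Fin (n + 1) → ℝ, qq n D f p ≤ qq n D f r + L * ∑ i, |p i - r i| := by
    intro p r
    refine le_of_forall_pos_le_add fun δ hδ => ?_
    obtain ⟨v, hv⟩ := qq_approx n D f r δ hδ
    have h1 := qq_le n L D f hD hlip p v
    have h2 := hlip (p + EE n v) (r + EE n v)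
    simp only [Pi.add_apply, add_sub_add_right_eq_sub] at h2
    have h3 := le_abs_self (f (p + EE n v) - f (r + EE n v))
    linarith
  rw [abs_le]
  have h1 := key p r
  have h2 := key r p
  have h3 : ∑ i, |r i - p i| = ∑ i, |p i - r i| := Finset.sum_congr rfl fun i _ => abs_sub_comm _ _
  rw [h3] at h2
  constructor <;> linarith

lemma EE_comb (a b v w : ℝ) : EE n (a * v + b * w) = a • EE n v + b • EE n w := by
  ext i
  refine Fin.cases ?_ (fun j => ?_) i <;> simp [EE]

lemma qq_conv (hD : 0 < D) (hf : ConvexOn ℝ Set.univ f)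
    (hlip : ∀ x y, |f x - f y| ≤ L * ∑ i, |x i - y i|) : ConvexOn ℝ Set.univ (qq n D f) := by
  refine ⟨convex_univ, fun p _ r _ a b ha hb hab => ?_⟩
  refine le_of_forall_pos_le_add fun δ hδ => ?_
  obtain ⟨v, hv⟩ := qq_approx n D f p δ hδ
  obtain ⟨w, hw⟩ := qq_approx n D f r δ hδ
  have h1 := qq_le n L D f hD hlip (a • p + b • r) (a * v + b * w)
  have h2 := hf.2 (mem_univ (p + EE n v)) (mem_univ (r + EE n w)) ha hb hab
  have h3 : a • (p + EE n v) + b • (r + EE n w) = a • p + b • r + EE n (a * v + b * w) := by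
    rw [EE_comb]; module
  rw [h3] at h2
  have h4 : (a * v + b * w) ^ 2 / (2 * D ^ 2) ≤ a * (v ^ 2 / (2 * D ^ 2)) + b * (w ^ 2 / (2 * D ^ 2)) := by
    have h5 : (a * v + b * w) ^ 2 ≤ a * v ^ 2 + b * w ^ 2 := by
      have hb' : b = 1 - a := by linarith
      subst hb'
      nlinarith [mul_nonneg (mul_nonneg ha hb) (sq_nonneg (v - w))]
    calc _ ≤ (a * v ^ 2 + b * w ^ 2) / (2 * D ^ 2) := by gcongr
      _ = _ := by ring
  simp only [smul_eq_mul] at h2 ⊢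
  have h6 := mul_le_mul_of_nonneg_left hv.le ha
  have h7 := mul_le_mul_of_nonneg_left hw.le hb
  have h8 : a * δ + b * δ = δ := by rw [← add_mul, hab, one_mul]
  linarith

end

lemma le_exp_iInf (c : ENNReal) (g : ℝ → ℝ) (k : ℝ)
    (hc : ∀ v, c ≤ ENNReal.ofReal (exp (g v + k))) : c ≤ ENNReal.ofReal (exp ((⨅ v, g v) + k)) := by
  have hct : c ≠ ⊤ := ne_top_of_le_ne_top ENNReal.ofReal_ne_top (hc 0)
  rcases eq_or_ne c 0 with rfl | h0
  · exact bot_le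
  have hpos : 0 < c.toReal := ENNReal.toReal_pos h0 hct
  rw [← ENNReal.ofReal_toReal hct] at hc ⊢
  apply ENNReal.ofReal_le_ofReal
  rw [← Real.log_le_iff_le_exp hpos]
  have : Real.log c.toReal - k ≤ ⨅ v, g v := by
    refine le_ciInf fun v => ?_
    have h1 := (ENNReal.ofReal_le_ofReal_iff (exp_pos _).le).mp (hc v)
    rw [← Real.log_le_iff_le_exp hpos] at h1
    linarith
  linarith

lemma lint_ne_zero (μ : Measure ℝ) [IsProbabilityMeasure μ] (k : ℝ → ℝ) (hk : Continuous k) :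
    ∫⁻ x, ENNReal.ofReal (exp (k x)) ∂μ ≠ 0 := by
  intro h0
  rw [lintegral_eq_zero_iff (by fun_prop)] at h0
  have : ∀ᵐ x ∂μ, False := by
    filter_upwards [h0] with x hx
    simp only [Pi.zero_apply, ENNReal.ofReal_eq_zero] at hx
    exact absurd hx (not_le.mpr (exp_pos _))
  rw [Filter.eventually_false_iff_eq_bot] at this
  exact (NeZero.ne μ) (ae_eq_bot.mp this)

lemma fubini_pi (n : ℕ) (μ : Fin (n + 1) → Measure ℝ) [∀ i, IsProbabilityMeasure (μ i)]
    (ψ : (Fin (n + 1) → ℝ) → ENNReal) (hψ : Measurable ψ) :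
    ∫⁻ x, ψ x ∂(Measure.pi μ) =
      ∫⁻ y, ∫⁻ x0, ψ (Fin.cons x0 y) ∂(μ 0) ∂(Measure.pi fun j : Fin n => μ j.succ) := by
  have hmp := (measurePreserving_piFinSuccAbove μ 0).symm
  rw [← hmp.lintegral_comp hψ, lintegral_prod_symm']
  · simp only [MeasurableEquiv.piFinSuccAbove_symm_apply, Fin.insertNthEquiv_zero]
    rfl
  · exact hψ.comp (MeasurableEquiv.measurable _)

theorem tensor (h l : ℝ) (hh : 0 < h) (hl0 : 0 ≤ l) (hl1 : l < 1) (L D : ℝ) (hL : 0 ≤ L) (hD0 : 0 < D)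
    (hLh : L * h = (1 - l) ^ 2 / 68) (hD : D = 17 * h / (1 - l) ^ 2) :
    ∀ (n : ℕ) (μ : Fin n → Measure ℝ) [∀ i, IsProbabilityMeasure (μ i)]
    (_ : ∀ i, (μ i).map (fun x => -x) = μ i)
    (_ : ∀ i, ∀ x : ℝ, 0 ≤ x →
      (μ i) (Set.Ici (x + h)) ≤ ENNReal.ofReal l * (μ i) (Set.Ici x))
    (f : (Fin n → ℝ) → ℝ) (_ : ConvexOn ℝ Set.univ f)
    (_ : ∀ x y, |f x - f y| ≤ L * ∑ i, |x i - y i|)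
    (φ : (Fin n → ℝ) → ENNReal) (_ : Measurable φ)
    (_ : ∀ x y, φ x ≤ ENNReal.ofReal (exp (f y + (∑ i, (x i - y i) ^ 2) / (2 * D ^ 2)))),
    (∫⁻ x, φ x ∂(Measure.pi μ)) * ∫⁻ x, ENNReal.ofReal (exp (- f x)) ∂(Measure.pi μ) ≤ 1 := by
  intro n
  induction n with
  | zero =>
    intro μ _ hsym htail f hf hlip φ hφm hφ
    have e1 : ∀ x, x = (default : Fin 0 → ℝ) := fun x => Subsingleton.elim _ _
    have e2 : (fun x => φ x) = fun _ => φ default := by ext x; rw [e1 x]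
    have e3 : (fun x => ENNReal.ofReal (exp (- f x))) = fun _ => ENNReal.ofReal (exp (- f default)) := by
      ext x; rw [e1 x]
    rw [e2, e3, lintegral_const, lintegral_const, measure_univ, mul_one, mul_one]
    have := hφ default default
    simp only [Finset.univ_eq_empty, Finset.sum_empty, zero_div, add_zero] at this
    calc _ ≤ ENNReal.ofReal (exp (f default)) * ENNReal.ofReal (exp (- f default)) := by gcongr
      _ = 1 := by rw [← ENNReal.ofReal_mul (exp_pos _).le, ← exp_add]; simp
  | succ n ih =>
    intro μ _ hsym htail f hf hlip φ hφm hφ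
    have hqlip := qq_lip n L D f hD0 hlip
    have hqconv := qq_conv n L D f hD0 hf hlip
    have hqc := lip_cont_pi (n + 1) (qq n D f) L hL hqlip
    have hfc := lip_cont_pi (n + 1) f L hL hlip
    have hcons : ∀ y : Fin n → ℝ, Continuous (fun x0 : ℝ => (Fin.cons x0 y : Fin (n + 1) → ℝ)) := by
      intro y
      refine continuous_pi fun i => ?_
      refine Fin.cases ?_ (fun j => ?_) i <;> simp <;> fun_prop
    have hqc' : ∀ y : Fin n → ℝ, Continuous (fun x0 : ℝ => qq n D f (Fin.cons x0 y)) :=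
      fun y => hqc.comp (hcons y)
    have hfc' : ∀ y : Fin n → ℝ, Continuous (fun x0 : ℝ => f (Fin.cons x0 y)) :=
      fun y => hfc.comp (hcons y)
    have hcc : ∀ (a b x z : ℝ) (y w : Fin n → ℝ), (Fin.cons (a * x + b * z) (a • y + b • w) : Fin (n + 1) → ℝ)
        = a • (Fin.cons x y : Fin (n + 1) → ℝ) + b • (Fin.cons z w : Fin (n + 1) → ℝ) := by
      intro a b x z y w
      ext i
      refine Fin.cases ?_ (fun j => ?_) i <;> simp
    set A : (Fin n → ℝ) → ENNReal := fun y => ∫⁻ x0, ENNReal.ofReal (exp (qq n D f (Fin.cons x0 y))) ∂(μ 0)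
      with hA
    set B : (Fin n → ℝ) → ENNReal := fun y => ∫⁻ x0, ENNReal.ofReal (exp (- f (Fin.cons x0 y))) ∂(μ 0)
      with hB
    have hAB : ∀ y, A y * B y ≤ 1 := by
      intro y
      refine oneDim (μ 0) h l hh hl0 hl1 (hsym 0) (htail 0) (fun x0 => f (Fin.cons x0 y)) ?_ L D hL hLh hD ?_
        _ ?_
      · refine ⟨convex_univ, fun x _ z _ a b ha hb hab => ?_⟩
        have h1 := hf.2 (mem_univ (Fin.cons x y)) (mem_univ (Fin.cons z y)) ha hb hab
        rw [← hcc, ← add_smul, hab, one_smul] at h1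
        exact h1
      · intro x z
        have := hlip (Fin.cons x y) (Fin.cons z y)
        rw [Fin.sum_univ_succ] at this
        simpa using this
      · intro x z
        apply ENNReal.ofReal_le_ofReal
        apply exp_le_exp.mpr
        have h1 := qq_le n L D f hD0 hlip (Fin.cons x y) (z - x)
        have h2 : (Fin.cons x y : Fin (n + 1) → ℝ) + EE n (z - x) = Fin.cons z y := by
          ext i
          refine Fin.cases ?_ (fun j => ?_) i <;> simp [EE]
        rw [h2] at h1
        rw [show (x - z) ^ 2 = (z - x) ^ 2 by ring]
        exact h1
    have hA0 : ∀ y, A y ≠ 0 := fun y => lint_ne_zero (μ 0) _ (hqc' y)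
    have hB0 : ∀ y, B y ≠ 0 := fun y => lint_ne_zero (μ 0) _ (hfc' y).neg
    have hAt : ∀ y, A y ≠ ⊤ := fun y ht => by
      have := hAB y
      rw [ht, ENNReal.top_mul (hB0 y)] at this
      exact absurd this (by simp)
    set G : (Fin n → ℝ) → ℝ := fun y => Real.log (A y).toReal with hG
    have hGA : ∀ y, ENNReal.ofReal (exp (G y)) = A y := fun y => by
      simp only [hG]
      rw [exp_log (ENNReal.toReal_pos (hA0 y) (hAt y)), ENNReal.ofReal_toReal (hAt y)]
    have hGle : ∀ y c, A y ≤ ENNReal.ofReal (exp c) → G y ≤ c := fun y c hc => by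
      rw [← hGA, ENNReal.ofReal_le_ofReal_iff (exp_pos _).le] at hc
      exact exp_le_exp.mp hc
    have hBG : ∀ y, B y ≤ ENNReal.ofReal (exp (- G y)) := fun y => by
      rw [exp_neg, ENNReal.ofReal_inv_of_pos (exp_pos _), hGA, ENNReal.le_inv_iff_mul_le, mul_comm]
      exact hAB y
    have hGlip : ∀ x y, |G x - G y| ≤ L * ∑ i, |x i - y i| := by
      have key : ∀ x y, G x ≤ G y + L * ∑ i, |x i - y i| := by
        intro x y
        apply hGle
        rw [exp_add, ENNReal.ofReal_mul (exp_pos _).le, hGA, mul_comm, hA]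
        simp only
        rw [← lintegral_const_mul' _ _ ENNReal.ofReal_ne_top]
        refine lintegral_mono fun x0 => ?_
        simp only
        rw [← ENNReal.ofReal_mul (exp_pos _).le, ← exp_add]
        apply ENNReal.ofReal_le_ofReal
        apply exp_le_exp.mpr
        have h1 := hqlip (Fin.cons x0 x) (Fin.cons x0 y)
        rw [Fin.sum_univ_succ] at h1
        simp only [Fin.cons_zero, Fin.cons_succ, sub_self, abs_zero, zero_add] at h1
        linarith [le_abs_self (qq n D f (Fin.cons x0 x) - qq n D f (Fin.cons x0 y))]
      intro p r
      rw [abs_le]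
      have h1 := key p r
      have h2 := key r p
      have h3 : ∑ i, |r i - p i| = ∑ i, |p i - r i| := Finset.sum_congr rfl fun i _ => abs_sub_comm _ _
      rw [h3] at h2
      constructor <;> linarith
    have hpow : ∀ c a : ℝ, 0 ≤ a → ENNReal.ofReal (exp c) ^ a = ENNReal.ofReal (exp (a * c)) := by
      intro c a ha
      rw [ENNReal.ofReal_rpow_of_nonneg (exp_pos _).le ha, ← exp_mul, mul_comm]
    have hGconv : ConvexOn ℝ Set.univ G := by
      refine ⟨convex_univ, fun y _ z _ a b ha hb hab => ?_⟩
      apply hGle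
      simp only [smul_eq_mul]
      rw [exp_add, ENNReal.ofReal_mul (exp_pos _).le, ← hpow _ _ ha, ← hpow _ _ hb, hGA, hGA]
      have hm : ∀ y, AEMeasurable (fun x0 => ENNReal.ofReal (exp (qq n D f (Fin.cons x0 y)))) (μ 0) := fun y =>
        ((continuous_exp.comp (hqc' y)).measurable.ennreal_ofReal).aemeasurable
      refine le_trans ?_ (ENNReal.lintegral_mul_norm_pow_le (hm y) (hm z) ha hb hab)
      refine lintegral_mono fun x0 => ?_
      simp only
      rw [hpow _ _ ha, hpow _ _ hb, ← ENNReal.ofReal_mul (exp_pos _).le, ← exp_add]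
      apply ENNReal.ofReal_le_ofReal
      apply exp_le_exp.mpr
      have h1 := hqconv.2 (mem_univ (Fin.cons x0 y)) (mem_univ (Fin.cons x0 z)) ha hb hab
      rw [← hcc, ← add_mul, hab, one_mul] at h1
      exact h1
    have hcm : Measurable (fun p : ℝ × (Fin n → ℝ) => (Fin.cons p.1 p.2 : Fin (n + 1) → ℝ)) := by
      refine measurable_pi_lambda _ fun i => ?_
      refine Fin.cases ?_ (fun j => ?_) i <;> simp <;> fun_prop
    have hih := ih (fun j => μ j.succ) (fun j => hsym _) (fun j => htail _) G hGconv hGlip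
      (fun y => ∫⁻ x0, φ (Fin.cons x0 y) ∂(μ 0))
      (Measurable.lintegral_prod_left' (hφm.comp hcm)) ?_
    · rw [fubini_pi n μ φ hφm, fubini_pi n μ _ (by
        have : Continuous (fun x => exp (- f x)) := by fun_prop
        exact this.measurable.ennreal_ofReal)]
      refine le_trans ?_ hih
      gcongr with y
      exact hBG y
    · intro x y
      rw [exp_add, ENNReal.ofReal_mul (exp_pos _).le, hGA, mul_comm, hA]
      simp only
      rw [← lintegral_const_mul' _ _ ENNReal.ofReal_ne_top]
      refine lintegral_mono fun x0 => ?_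
      simp only
      rw [← ENNReal.ofReal_mul (exp_pos _).le, ← exp_add, add_comm (_ / _)]
      refine le_exp_iInf _ _ _ fun v => ?_
      refine (hφ (Fin.cons x0 x) (Fin.cons x0 y + EE n v)).trans (le_of_eq ?_)
      congr 2
      rw [Fin.sum_univ_succ]
      simp only [EE, Pi.add_apply, Fin.cons_zero, Fin.cons_succ, Pi.zero_apply, add_zero]
      ring

theorem stmt14 (n : ℕ) (μ : Fin n → Measure ℝ) [∀ i, IsProbabilityMeasure (μ i)]
    (h l : ℝ) (hh : 0 < h) (hl0 : 0 ≤ l) (hl1 : l < 1)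
    (hsym : ∀ i, (μ i).map (fun x => -x) = μ i)
    (htail : ∀ i, ∀ x : ℝ, 0 ≤ x →
      (μ i) (Set.Ici (x + h)) ≤ ENNReal.ofReal l * (μ i) (Set.Ici x))
    (Cτ : ℝ) (hCτ : Cτ = 17 * h / (1 - l) ^ 2)
    (f : (Fin n → ℝ) → ℝ) (hconv : ConvexOn ℝ Set.univ f)
    (a b : ℝ) (ha : 0 < a) (hb : 0 < b)
    (hlip2 : ∀ x y : Fin n → ℝ, |f x - f y| ≤ a * Real.sqrt (∑ i, (x i - y i) ^ 2))
    (hlip1 : ∀ x y : Fin n → ℝ, |f x - f y| ≤ b * ∑ i, |x i - y i|)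
    (m : ℝ)
    (hmed1 : ENNReal.ofReal (1 / 2) ≤ Measure.pi μ {x | f x ≤ m})
    (hmed2 : ENNReal.ofReal (1 / 2) ≤ Measure.pi μ {x | m ≤ f x}) :
    ∀ t : ℝ, 0 ≤ t →
      Measure.pi μ {x | m + Cτ * t < f x} ≤
        ENNReal.ofReal (2 * Real.exp (-(1 / 8) * min (t / b) (t ^ 2 / a ^ 2))) := by
  intro t ht
  have he0 : 0 < 1 - l := by linarith
  have hC : 0 < Cτ := by rw [hCτ]; positivity
  obtain ⟨s, hs⟩ : ∃ s, s = 1 / 8 * min (t / b) (t ^ 2 / a ^ 2) := ⟨_, rfl⟩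
  have hs1 : s ≤ 1 / 8 * (t / b) := by rw [hs]; gcongr; exact min_le_left _ _
  have hs2 : s ≤ 1 / 8 * (t ^ 2 / a ^ 2) := by rw [hs]; gcongr; exact min_le_right _ _
  have hLb : 0 < 1 / (4 * Cτ * b) := by positivity
  obtain ⟨F, hF⟩ : ∃ F : (Fin n → ℝ) → ℝ, F = fun y => 1 / (4 * Cτ * b) * max (f y - m) 0 := ⟨_, rfl⟩
  have hFx : ∀ y, F y = 1 / (4 * Cτ * b) * max (f y - m) 0 := fun y => by rw [hF]
  have hfc : Continuous f := lip_cont_pi n f b hb.le hlip1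
  have hFpos : ∀ y, 0 ≤ F y := fun y => by rw [hFx]; positivity
  have hFconv : ConvexOn ℝ Set.univ F := by
    rw [hF]
    exact ((hconv.sub (concaveOn_const m convex_univ)).sup (convexOn_const 0 convex_univ)).smul hLb.le
  have hFlip : ∀ x y, |F x - F y| ≤ 1 / (4 * Cτ) * ∑ i, |x i - y i| := fun x y => by
    rw [hFx, hFx, ← mul_sub, abs_mul, abs_of_pos hLb]
    have h1 := abs_max_sub_max_le_abs (f x - m) (f y - m) 0
    rw [sub_sub_sub_cancel_right] at h1
    calc _ ≤ 1 / (4 * Cτ * b) * (b * ∑ i, |x i - y i|) :=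
          mul_le_mul_of_nonneg_left (h1.trans (hlip1 x y)) hLb.le
      _ = _ := by field_simp
  have hSm : MeasurableSet {x | m + Cτ * t < f x} := (isOpen_lt continuous_const hfc).measurableSet
  have hT := tensor h l hh hl0 hl1 (1 / (4 * Cτ)) Cτ (by positivity) hC
    (by rw [hCτ]; field_simp; norm_num) hCτ n μ hsym htail F hFconv hFlip
    ({x | m + Cτ * t < f x}.indicator fun _ => ENNReal.ofReal (exp s))
    (measurable_const.indicator hSm) (by
      intro x y
      rw [Set.indicator_apply]
      split_ifs with hx
      swap
      · exact bot_le
      have hx : m + Cτ * t < f x := hx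
      apply ENNReal.ofReal_le_ofReal
      apply exp_le_exp.mpr
      obtain ⟨d, hd⟩ : ∃ d, d = Real.sqrt (∑ i, (x i - y i) ^ 2) := ⟨_, rfl⟩
      have hd2 : ∑ i, (x i - y i) ^ 2 = d ^ 2 := by
        rw [hd, Real.sq_sqrt (Finset.sum_nonneg fun i _ => sq_nonneg _)]
      have hd0 : 0 ≤ d := by rw [hd]; positivity
      rw [hd2]
      have hl2 := hlip2 x y
      rw [← hd] at hl2
      rcases le_or_gt (Cτ * t / (2 * a)) d with hc | hc
      · have h1 : (Cτ * t / (2 * a)) ^ 2 ≤ d ^ 2 := pow_le_pow_left₀ (by positivity) hc 2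
        have h2 : (Cτ * t / (2 * a)) ^ 2 / (2 * Cτ ^ 2) ≤ d ^ 2 / (2 * Cτ ^ 2) := by gcongr
        have h3 : (Cτ * t / (2 * a)) ^ 2 / (2 * Cτ ^ 2) = 1 / 8 * (t ^ 2 / a ^ 2) := by
          field_simp; norm_num
        linarith [hFpos y]
      · have h1 : a * d ≤ Cτ * t / 2 := by
          calc a * d ≤ a * (Cτ * t / (2 * a)) := mul_le_mul_of_nonneg_left hc.le ha.le
            _ = _ := by field_simp
        have h2 := le_abs_self (f x - f y)
        have h3 : Cτ * t / 2 ≤ max (f y - m) 0 := le_trans (by linarith) (le_max_left _ _)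
        have h4 : 1 / (4 * Cτ * b) * (Cτ * t / 2) ≤ F y := by
          rw [hFx]; exact mul_le_mul_of_nonneg_left h3 hLb.le
        have h5 : 1 / (4 * Cτ * b) * (Cτ * t / 2) = 1 / 8 * (t / b) := by field_simp; ring
        have h6 : 0 ≤ d ^ 2 / (2 * Cτ ^ 2) := by positivity
        linarith)
  rw [lintegral_indicator_const hSm] at hT
  have hMm : MeasurableSet {x | f x ≤ m} := (isClosed_le hfc continuous_const).measurableSet
  have hlow : ENNReal.ofReal (1 / 2) ≤ ∫⁻ x, ENNReal.ofReal (exp (- F x)) ∂(Measure.pi μ) := by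
    refine hmed1.trans ?_
    rw [← lintegral_indicator_one hMm]
    refine lintegral_mono fun x => ?_
    rw [Set.indicator_apply]
    split_ifs with hx
    swap
    · exact bot_le
    have hx : f x ≤ m := hx
    have : F x = 0 := by rw [hFx, max_eq_right (by linarith), mul_zero]
    simp [this]
  have hfin : ENNReal.ofReal (exp s) * Measure.pi μ {x | m + Cτ * t < f x} * ENNReal.ofReal (1 / 2) ≤ 1 :=
    le_trans (by gcongr) hT
  have hrew : -(1 / 8) * min (t / b) (t ^ 2 / a ^ 2) = -s := by rw [hs]; ring
  rw [hrew]
  have hone : ENNReal.ofReal (2 * exp (-s)) * (ENNReal.ofReal (exp s) * ENNReal.ofReal (1 / 2)) = 1 := by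
    rw [← ENNReal.ofReal_mul (exp_pos _).le, ← ENNReal.ofReal_mul (by positivity)]
    rw [show 2 * exp (-s) * (exp s * (1 / 2)) = exp (-s) * exp s by ring, ← exp_add]
    simp
  calc Measure.pi μ {x | m + Cτ * t < f x}
      = (ENNReal.ofReal (2 * exp (-s)) * (ENNReal.ofReal (exp s) * ENNReal.ofReal (1 / 2))) *
        Measure.pi μ {x | m + Cτ * t < f x} := by rw [hone, one_mul]
    _ = ENNReal.ofReal (2 * exp (-s)) *
        (ENNReal.ofReal (exp s) * Measure.pi μ {x | m + Cτ * t < f x} * ENNReal.ofReal (1 / 2)) := by ring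
    _ ≤ ENNReal.ofReal (2 * exp (-s)) * 1 := by gcongr
    _ = _ := mul_one _
end
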